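/- (Benkart–Sottile–Stroomer) Let S and T be skew semistandard Young tableaux such that T extends S (S has shape λ/μ and T has shape ν/λ for some partitions μ ≤ λ ≤ ν), and let ^S T ∪ S_T be the result of the tableau switching procedure applied to S ∪ T. Then: (1) ^S T and S_T are skew semistandard Young tableaux, and S_T extends ^S T; (2) ^S T ∪ S_T occupies the same set of boxes ν/μ as S ∪ T; (3) Rect(S_T) = Rect(S); (4) Rect(^S T) = Rect(T). -/

import Mathlib

open scoped BigOperators

namespace SLR

/-- A partition, given as the weakly decreasing, eventually zero sequence of its
parts (`p i` is the `(i+1)`-st part). -/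
def IsPartitionFun (p : ℕ → ℕ) : Prop :=
  (∀ i, p (i + 1) ≤ p i) ∧ ∃ N, p N = 0

/-- A strict partition: the positive parts strictly decrease. -/
def IsStrictPartitionFun (p : ℕ → ℕ) : Prop :=
  ∀ i, p (i + 1) < p i ∨ p (i + 1) = 0

/-- The number `l(λ)` of (nonzero) parts of a partition. -/
noncomputable def len (p : ℕ → ℕ) : ℕ := Set.ncard {i | p i ≠ 0}

/-- The size `|λ|` of a partition: the sum of its parts. -/
noncomputable def size (p : ℕ → ℕ) : ℕ := ∑ᶠ i, p i

/-- `(i,j)` (0-indexed row, column) is a cell of the Young diagram of `p`. -/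
def YCell (p : ℕ → ℕ) (i j : ℕ) : Prop := j < p i

/-- `(i,j)` is a cell of the shifted diagram of the strict partition `p`:
row `i` has `p i` boxes starting in column `i`. -/
def SCell (p : ℕ → ℕ) (i j : ℕ) : Prop := i ≤ j ∧ j < i + p i

/-- Cell of the skew Young diagram `ν/μ`. -/
def SkewYCell (nu mu : ℕ → ℕ) (i j : ℕ) : Prop := YCell nu i j ∧ ¬ YCell mu i j

/-- Cell of the skew shifted diagram `ν/μ`. -/
def SkewSCell (nu mu : ℕ → ℕ) (i j : ℕ) : Prop := SCell nu i j ∧ ¬ SCell mu i j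

/-- Letters of the marked alphabet `1' < 1 < 2' < 2 < ⋯` are encoded by positive
integers: `k'` is encoded as `2k-1` and `k` as `2k`; the order of `ℕ` restricts to
the order of the alphabet, and a letter is marked iff its code is odd.
`mval e` is the value `k` of the letter encoded by `e`. -/
def mval (e : ℕ) : ℕ := (e + 1) / 2

/-- A skew semistandard Young tableau of shape `ν/μ` (over the unmarked alphabet
`1 < 2 < ⋯`), encoded as the function giving the entry of each cell (`0` outside
the shape): rows weakly increase, columns strictly increase. -/
def IsSkewSSYT (nu mu : ℕ → ℕ) (T : ℕ → ℕ → ℕ) : Prop :=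
  (∀ i j, T i j ≠ 0 ↔ SkewYCell nu mu i j) ∧
  (∀ i j j', j ≤ j' → SkewYCell nu mu i j → SkewYCell nu mu i j' → T i j ≤ T i j') ∧
  (∀ i i' j, i < i' → SkewYCell nu mu i j → SkewYCell nu mu i' j → T i j < T i' j)

/-- A filling of the cells given by `cell` with letters of the marked alphabet
(encoded as above), with weakly increasing rows and columns, at most one `k'`
in each row and at most one `k` in each column, for every `k`. -/
def IsMarkedFilling (cell : ℕ → ℕ → Prop) (T : ℕ → ℕ → ℕ) : Prop :=
  (∀ i j, T i j ≠ 0 ↔ cell i j) ∧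
  (∀ i j j', j ≤ j' → cell i j → cell i j' → T i j ≤ T i j') ∧
  (∀ i i' j, i ≤ i' → cell i j → cell i' j → T i j ≤ T i' j) ∧
  (∀ i j j', j < j' → cell i j → cell i j' → T i j = T i j' → T i j % 2 = 0) ∧
  (∀ i i' j, i < i' → cell i j → cell i' j → T i j = T i' j → T i j % 2 = 1)

/-- The Schur function `s_p`, as a formal power series in the variables
`x_1, x_2, ⋯` (variable `x_{k+1}` is indexed by `k : ℕ`): the coefficient of the
monomial with exponents `d` is the number of semistandard Young tableaux of
shape `p` and content `d`. -/
noncomputable def schur (p : ℕ → ℕ) : MvPowerSeries ℕ ℚ :=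
  fun d => (Nat.card {T : ℕ → ℕ → ℕ //
    IsSkewSSYT p (fun _ => 0) T ∧
      ∀ k, d k = Set.ncard {c : ℕ × ℕ | T c.1 c.2 = k + 1}} : ℚ)

/-- The Schur Q-function `Q_p` of a strict partition `p`: the coefficient of the
monomial with exponents `d` is the number of shifted tableaux of shifted shape `p`
(fillings by the marked alphabet) of content `d`. -/
noncomputable def schurQ (p : ℕ → ℕ) : MvPowerSeries ℕ ℚ :=
  fun d => (Nat.card {T : ℕ → ℕ → ℕ //
    IsMarkedFilling (SCell p) T ∧
      ∀ k, d k = Set.ncard {c : ℕ × ℕ | mval (T c.1 c.2) = k + 1}} : ℚ)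

/-- `P_λ = 2^{-l(λ)} Q_λ`. -/
noncomputable def Pfun (p : ℕ → ℕ) : MvPowerSeries ℕ ℚ :=
  ((2 : ℚ) ^ len p)⁻¹ • schurQ p

/-- The content of a marked filling is `γ`: `γ k` is the number of entries equal
to `k+1` or `(k+1)'`. -/
def HasContent (T : ℕ → ℕ → ℕ) (γ : ℕ → ℕ) : Prop :=
  ∀ k, γ k = Set.ncard {c : ℕ × ℕ | mval (T c.1 c.2) = k + 1}

/-- The word of a skew shifted tableau: rows read left to right, bottom row first. -/
noncomputable def sword (nu mu : ℕ → ℕ) (T : ℕ → ℕ → ℕ) : List ℕ :=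
  (List.range (len nu)).reverse.flatMap fun i =>
    ((List.range (i + nu i)).filter fun j => decide (i + mu i ≤ j)).map (T i)

/-- The word of a filling of the Young diagram of `mu`: rows read left to right,
bottom row first. -/
noncomputable def yword (mu : ℕ → ℕ) (T : ℕ → ℕ → ℕ) : List ℕ :=
  (List.range (len mu)).reverse.flatMap fun i => (List.range (mu i)).map (T i)

/-- The statistics `m_i(j)`, `0 ≤ j ≤ 2n`, of a word `w` over the marked alphabet:
for `j ≤ n`, the multiplicity of (unmarked) `i` among `w_n, …, w_{n-j+1}`; for
`n < j ≤ 2n`, the multiplicity of `i'` among `w_1, …, w_{j-n}` plus the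
multiplicity of `i` in the whole word. -/
def mstat (w : List ℕ) (i j : ℕ) : ℕ :=
  if j ≤ w.length then (w.reverse.take j).count (2 * i)
  else (w.take (j - w.length)).count (2 * i - 1) + w.count (2 * i)

/-- `w` is a shifted lattice word. -/
def IsShiftedLatticeWord (w : List ℕ) : Prop :=
  ∀ i, 1 ≤ i → ∀ j,
    (j < w.length → mstat w i j = mstat w (i - 1) j →
      w.getD (w.length - j - 1) 0 ≠ 2 * i ∧ w.getD (w.length - j - 1) 0 ≠ 2 * i - 1) ∧
    (w.length ≤ j → j < 2 * w.length → mstat w i j = mstat w (i - 1) j →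
      w.getD (j - w.length) 0 ≠ 2 * (i - 1) ∧ w.getD (j - w.length) 0 ≠ 2 * i - 1)

/-- Condition (F1)/(G1): for every `k`, the leftmost of the letters `k, k'`
occurring in `w` is unmarked. -/
def LeftmostUnmarked (w : List ℕ) : Prop :=
  ∀ k p, 1 ≤ k → w.getD p 0 = 2 * k - 1 → ∃ q, q < p ∧ w.getD q 0 = 2 * k

/-- Stembridge's tableaux: skew shifted tableaux of shape `ν/μ` and content `λ`
satisfying (F1) and (F2). -/
def IsStembridgeTab (lam mu nu : ℕ → ℕ) (T : ℕ → ℕ → ℕ) : Prop :=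
  IsMarkedFilling (SkewSCell nu mu) T ∧ HasContent T lam ∧
  LeftmostUnmarked (sword nu mu T) ∧ IsShiftedLatticeWord (sword nu mu T)

/-- The number given to the cell `(i,j)` of the skew shifted diagram `ν/μ` by the
shifted reverse filling (rows top to bottom, right to left within each row). -/
def srfNum (nu mu : ℕ → ℕ) (i j : ℕ) : ℕ :=
  (∑ r ∈ Finset.range i, (nu r - mu r)) + (i + nu i - j)

/-- The number given to the cell `(i,j)` of the skew Young diagram `ν/λ` by the
reverse filling (rows top to bottom, right to left within each row). -/
def yrfNum (nu la : ℕ → ℕ) (i j : ℕ) : ℕ :=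
  (∑ r ∈ Finset.range i, (nu r - la r)) + (nu i - j)

/-- Rank of an encoded letter in the order `1 < 2 < ⋯ < N < N' < ⋯ < 2' < 1'`. -/
def rnk (N e : ℕ) : ℕ := if e % 2 = 0 then e / 2 else 2 * N + 1 - (e + 1) / 2

/-- The list of entries of row `i` of a filling of the Young diagram of `sh`. -/
def rowL (sh : ℕ → ℕ) (T : ℕ → ℕ → ℕ) (i : ℕ) : List ℕ := (List.range (sh i)).map (T i)

/-- Row `i`, reordered according to the order `1 < 2 < ⋯ < N < N' < ⋯ < 2' < 1'`. -/
def rowS (N : ℕ) (sh : ℕ → ℕ) (T : ℕ → ℕ → ℕ) (i : ℕ) : List ℕ :=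
  (rowL sh T i).mergeSort fun a b => decide (rnk N a ≤ rnk N b)

/-- The number of entries of row `i` of rank less than `r` in the order
`1 < 2 < ⋯ < N < N' < ⋯ < 2' < 1'`. -/
def cntLess (N : ℕ) (sh : ℕ → ℕ) (T : ℕ → ℕ → ℕ) (i r : ℕ) : ℕ :=
  (rowL sh T i).countP fun e => decide (rnk N e < r)

/-- Condition (C4) on a labelled tableau of shape `sh`. -/
def C4 (N : ℕ) (sh : ℕ → ℕ) (T : ℕ → ℕ → ℕ) : Prop :=
  (∀ i c, c < sh (i + 1) →
    rnk N ((rowS N sh T i).getD c 0) < rnk N ((rowS N sh T (i + 1)).getD c 0)) ∧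
  (∀ i j, 1 ≤ i → 1 ≤ j → (2 * j - 1) ∈ rowL sh T i →
    cntLess N sh T i j < cntLess N sh T (i - 1) j) ∧
  (∀ i j, 1 ≤ j → (2 * j) ∈ rowL sh T i →
    cntLess N sh T (i + 1) (2 * N + 1 - j) < cntLess N sh T i (2 * N + 1 - j))

/-- Membership in the set `Õ(ν/μ)`: `T` is a filling of the (unshifted) Young
diagram of `sh` by the alphabet `1' < 1 < ⋯ < N' < N` (`N = |ν/μ|`), where for
each `1 ≤ k ≤ N` exactly one of `k, k'` occurs, satisfying the conditions
(C1)–(C4) relative to the shifted reverse filling of `ν/μ`. -/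
def InOtilde (nu mu sh : ℕ → ℕ) (T : ℕ → ℕ → ℕ) : Prop :=
  (∀ i j, T i j ≠ 0 ↔ YCell sh i j) ∧
  (∀ i j, YCell sh i j → T i j ≤ 2 * (size nu - size mu)) ∧
  (∀ k, 1 ≤ k → k ≤ size nu - size mu →
      ∃! c : ℕ × ℕ, YCell sh c.1 c.2 ∧ mval (T c.1 c.2) = k) ∧
  -- (C1): if `k` and `k+1` lie in the same row of the shifted reverse filling,
  -- then the entry of value `k+1` lies weakly above the entry of value `k` when
  -- the latter is unmarked, and strictly above it when it is marked.
  (∀ k i j, SkewSCell nu mu i j → SkewSCell nu mu i (j + 1) → srfNum nu mu i (j + 1) = k →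
    ∀ a b a' b', YCell sh a b → YCell sh a' b' →
      mval (T a b) = k → mval (T a' b') = k + 1 →
        (T a b % 2 = 0 → a' ≤ a) ∧ (T a b % 2 = 1 → a' < a)) ∧
  -- (C2): if `h` lies directly below `k` in the shifted reverse filling, then the
  -- entry of value `h` lies weakly below the entry of value `k` when the latter is
  -- marked, and strictly below it when it is unmarked.
  (∀ i j, SkewSCell nu mu i j → SkewSCell nu mu (i + 1) j →
    ∀ a b a' b', YCell sh a b → YCell sh a' b' →
      mval (T a b) = srfNum nu mu i j → mval (T a' b') = srfNum nu mu (i + 1) j →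
        (T a b % 2 = 1 → a ≤ a') ∧ (T a b % 2 = 0 → a < a')) ∧
  -- (C3): the rightmost letter in each row is unmarked.
  (∀ i j, YCell sh i j → ¬ YCell sh i (j + 1) → T i j % 2 = 0) ∧
  C4 (size nu - size mu) sh T

/-- Schensted row-insertion of `x` into a tableau given as its list of rows. -/
def insert1 : List (List ℕ) → ℕ → List (List ℕ)
  | [], x => [[x]]
  | r :: rs, x =>
    match r.findIdx? (fun y => decide (x < y)) with
    | none => (r ++ [x]) :: rs
    | some j => (r.set j x) :: insert1 rs (r.getD j 0)

/-- The reading word of a tableau given as its list of rows: rows left to right,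
bottom row first. -/
def lword (U : List (List ℕ)) : List ℕ := U.reverse.flatten

/-- The product tableau `A.U`: row-insert the letters of the word of `U`
successively into `A`. -/
def prodT (A U : List (List ℕ)) : List (List ℕ) := (lword U).foldl insert1 A

/-- The transpose of a tableau given as its list of rows. -/
def transposeL (U : List (List ℕ)) : List (List ℕ) :=
  (List.range (U.headD []).length).map fun j => U.filterMap fun r => r[j]?

/-- `U` (as a list of rows) is a standard Young tableau of shape `mu`. -/
def IsSYTL (mu : ℕ → ℕ) (U : List (List ℕ)) : Prop :=
  U.length = len mu ∧
  (∀ i, (U.getD i []).length = mu i) ∧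
  (U.flatten).Perm (List.range' 1 (size mu)) ∧
  (∀ i j, j + 1 < mu i → (U.getD i []).getD j 0 < (U.getD i []).getD (j + 1) 0) ∧
  (∀ i j, j < mu (i + 1) → (U.getD i []).getD j 0 < (U.getD (i + 1) []).getD j 0)

/-- `U` (as a list of rows) is a semistandard Young tableau of shape `mu`. -/
def IsSSYTL (mu : ℕ → ℕ) (U : List (List ℕ)) : Prop :=
  U.length = len mu ∧
  (∀ i, (U.getD i []).length = mu i) ∧
  (∀ i j, j < mu i → 1 ≤ (U.getD i []).getD j 0) ∧
  (∀ i j, j + 1 < mu i → (U.getD i []).getD j 0 ≤ (U.getD i []).getD (j + 1) 0) ∧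
  (∀ i j, j < mu (i + 1) → (U.getD i []).getD j 0 < (U.getD (i + 1) []).getD j 0)

/-- The entry of the canonical standard shifted tableau `T_λ` (filled row by row,
from top to bottom and left to right, with `1, 2, …, n`) at shifted cell `(r,c)`. -/
def tval (lam : ℕ → ℕ) (r c : ℕ) : ℕ := (∑ t ∈ Finset.range r, lam t) + (c - r) + 1

/-- Row `i` of `s(T_λ)`, the tableau obtained by gluing `T_λ` and its reflection
through the main diagonal along that diagonal (diagonal boxes doubled). -/
def sTrow (lam : ℕ → ℕ) (i : ℕ) : List ℕ :=
  ((List.range i).filterMap fun c => if i < c + lam c then some (tval lam c i) else none)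
    ++ (if 0 < lam i then [tval lam i i] else [])
    ++ ((List.range (lam i)).map fun t => tval lam i (i + t))

/-- `s(T_λ)` as a list of rows. -/
def sT (lam : ℕ → ℕ) : List (List ℕ) := (List.range (lam 0)).map (sTrow lam)

/-- Update of a filling at one cell. -/
def upd2 (T : ℕ → ℕ → ℕ) (i j v : ℕ) : ℕ → ℕ → ℕ :=
  fun a b => if a = i ∧ b = j then v else T a b

/-- One jeu de taquin slide, starting with the hole at `(i,j)`: repeatedly move
into the hole the smaller of its right and lower neighbours (the lower one in case
of a tie), until both are missing (`fuel` is a recursion bound). -/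
def slideAux : ℕ → (ℕ → ℕ → ℕ) → ℕ → ℕ → (ℕ → ℕ → ℕ)
  | 0, T, _, _ => T
  | fuel + 1, T, i, j =>
    let r := T i (j + 1)
    let d := T (i + 1) j
    if r = 0 ∧ d = 0 then T
    else if d = 0 ∨ (r ≠ 0 ∧ r < d) then
      slideAux fuel (upd2 (upd2 T i j r) i (j + 1) 0) i (j + 1)
    else
      slideAux fuel (upd2 (upd2 T i j d) (i + 1) j 0) (i + 1) j

/-- The last index of a nonzero entry of a list. -/
def lastPos (l : List ℕ) : Option ℕ :=
  (List.range l.length).reverse.find? fun i => decide (l.getD i 0 ≠ 0)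

/-- Jeu de taquin rectification of a skew Young tableau whose inner shape is the
partition `m` (as a list): while `m` is nonempty, slide out the inner corner at the
end of the last row of `m`.  Since the rectification is independent of the choice
of inner corners, this computes the rectification. -/
def rectSteps (B : ℕ) : ℕ → List ℕ → (ℕ → ℕ → ℕ) → (ℕ → ℕ → ℕ)
  | 0, _, T => T
  | steps + 1, m, T =>
    match lastPos m with
    | none => T
    | some r => rectSteps B steps (m.set r (m.getD r 0 - 1)) (slideAux B T r (m.getD r 0 - 1))

/-- Shifted jeu de taquin rectification of a skew shifted tableau whose inner
(strict) shape is `m`: while `m` is nonempty, slide out the inner corner at the end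
of the last row of `m`. -/
def srectSteps (B : ℕ) : ℕ → List ℕ → (ℕ → ℕ → ℕ) → (ℕ → ℕ → ℕ)
  | 0, _, T => T
  | steps + 1, m, T =>
    match lastPos m with
    | none => T
    | some r =>
      srectSteps B steps (m.set r (m.getD r 0 - 1)) (slideAux B T r (r + m.getD r 0 - 1))

/-- The list `[μ_1, …, μ_l]` of parts of a partition given as a function. -/
noncomputable def muList (mu : ℕ → ℕ) : List ℕ := (List.range (len mu)).map mu

/-- Jeu de taquin rectification of a filling of the skew Young diagram `ν/μ`. -/
noncomputable def RectOf (nu mu : ℕ → ℕ) (T : ℕ → ℕ → ℕ) : ℕ → ℕ → ℕ :=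
  rectSteps (size nu + len nu + nu 0 + 2) (size mu) (muList mu) T

/-- Shifted jeu de taquin rectification of a filling of the skew shifted
diagram `ν/μ`. -/
noncomputable def sRectOf (nu mu : ℕ → ℕ) (T : ℕ → ℕ → ℕ) : ℕ → ℕ → ℕ :=
  srectSteps (size nu + len nu + nu 0 + 2) (size mu) (muList mu) T

/-- `s(T)`: glue an (unmarked) skew shifted tableau `T` with its reflection through
the main diagonal, the diagonal boxes being doubled. -/
def glue (T : ℕ → ℕ → ℕ) : ℕ → ℕ → ℕ := fun i j => if j ≤ i then T j i else T i (j - 1)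

/-- `λ̃`: the partition whose Young diagram is the union of the shifted diagram of
the strict partition `λ` and its reflection through the main diagonal. -/
noncomputable def tilde (lam : ℕ → ℕ) : ℕ → ℕ :=
  fun i => Set.ncard {j | SCell lam i j ∨ SCell lam j i}

/-- The list of rows of `λ̃`. -/
noncomputable def tildeList (lam : ℕ → ℕ) : List ℕ := (List.range (lam 0)).map (tilde lam)

/-- The conjugate (transpose) partition `μ^t`. -/
noncomputable def conj (mu : ℕ → ℕ) : ℕ → ℕ := fun i => Set.ncard {j | i < mu j}

/-- A standard skew shifted tableau of shape `ν/μ`: no marked entries, entries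
`1, 2, …, |ν/μ|`, each occurring exactly once, increasing along rows and columns. -/
def IsStdSkewShifted (nu mu : ℕ → ℕ) (T : ℕ → ℕ → ℕ) : Prop :=
  (∀ i j, T i j ≠ 0 ↔ SkewSCell nu mu i j) ∧
  (∀ i j, SkewSCell nu mu i j → T i j ≤ size nu - size mu) ∧
  (∀ i j j', j < j' → SkewSCell nu mu i j → SkewSCell nu mu i j' → T i j < T i j') ∧
  (∀ i i' j, i < i' → SkewSCell nu mu i j → SkewSCell nu mu i' j → T i j < T i' j) ∧
  (∀ k, 1 ≤ k → k ≤ size nu - size mu → ∃! c : ℕ × ℕ, T c.1 c.2 = k)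

/-- A skew shifted semistandard tableau with no marked entries: rows weakly
increasing, columns strictly increasing. -/
def IsSkewShiftedSSYT (nu mu : ℕ → ℕ) (T : ℕ → ℕ → ℕ) : Prop :=
  (∀ i j, T i j ≠ 0 ↔ SkewSCell nu mu i j) ∧
  (∀ i j j', j ≤ j' → SkewSCell nu mu i j → SkewSCell nu mu i j' → T i j ≤ T i j') ∧
  (∀ i i' j, i < i' → SkewSCell nu mu i j → SkewSCell nu mu i' j → T i j < T i' j)

/-- The map sending a skew shifted tableau `T` of shape `ν/μ` with word
`w(T) = w_1 ⋯ w_N` to the tableau of unshifted shape in which, for each `i`, the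
value `N+1-i` (marked iff `w_i` is marked) is placed in row `k`, where
`w_i ∈ {k, k'}` (each row filled from left to right as `i` decreases). -/
noncomputable def stemToO (nu mu : ℕ → ℕ) (T : ℕ → ℕ → ℕ) : ℕ → ℕ → ℕ := fun k c =>
  (let w := sword nu mu T
   (List.range w.length).filterMap fun t =>
     let e := w.getD (w.length - t - 1) 0
     if mval e = k + 1 then
       some (if e % 2 = 1 then 2 * (t + 1) - 1 else 2 * (t + 1))
     else none).getD c 0

/-- A perforated tableau of shape `γ`: a partial filling (0 = empty) of the cells
of `γ`, with strictly increasing columns, such that every entry weakly northwest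
of an entry is at most that entry. -/
def IsPerforated (γ : ℕ → ℕ → Prop) (S : ℕ → ℕ → ℕ) : Prop :=
  (∀ i j, S i j ≠ 0 → γ i j) ∧
  (∀ i i' j, i < i' → S i j ≠ 0 → S i' j ≠ 0 → S i j < S i' j) ∧
  (∀ i j i' j', i' ≤ i → j' ≤ j → S i' j' ≠ 0 → S i j ≠ 0 → S i' j' ≤ S i j)

/-- One step of the switching procedure on a perforated pair `(S,T)` filling `γ`:
interchange an entry `s` of `S` with an adjacent entry `t` of `T` lying directly
below or directly to the right of `s`, provided both parts remain perforated
tableaux of `γ`. -/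
def SwitchStep (γ : ℕ → ℕ → Prop) (p q : (ℕ → ℕ → ℕ) × (ℕ → ℕ → ℕ)) : Prop :=
  ∃ i j i' j', p.1 i j ≠ 0 ∧ p.2 i' j' ≠ 0 ∧
    ((i' = i ∧ j' = j + 1) ∨ (i' = i + 1 ∧ j' = j)) ∧
    q.1 = upd2 (upd2 p.1 i j 0) i' j' (p.1 i j) ∧
    q.2 = upd2 (upd2 p.2 i' j' 0) i j (p.2 i' j') ∧
    IsPerforated γ q.1 ∧ IsPerforated γ q.2

/-- The result of the switching procedure applied to the pair `p = (S,T)`: the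
(unique) pair reachable from `p` by switching steps to which no further step
applies; its first component is `S_T` and its second is `^S T`. -/
noncomputable def switchResult (γ : ℕ → ℕ → Prop) (p : (ℕ → ℕ → ℕ) × (ℕ → ℕ → ℕ)) :
    (ℕ → ℕ → ℕ) × (ℕ → ℕ → ℕ) :=
  Classical.epsilon fun q =>
    Relation.ReflTransGen (SwitchStep γ) p q ∧ ∀ r, ¬ SwitchStep γ q r

/-- The Schur Q-function, with integer coefficients. -/
noncomputable def schurQZ (p : ℕ → ℕ) : MvPowerSeries ℕ ℤ :=
  fun d => (Nat.card {T : ℕ → ℕ → ℕ //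
    IsMarkedFilling (SCell p) T ∧
      ∀ k, d k = Set.ncard {c : ℕ × ℕ | mval (T c.1 c.2) = k + 1}} : ℤ)


/-- Two partial fillings have disjoint supports. -/
def Disj (p : (ℕ → ℕ → ℕ) × (ℕ → ℕ → ℕ)) : Prop := ∀ i j, p.1 i j = 0 ∨ p.2 i j = 0

lemma upd2_self (F : ℕ → ℕ → ℕ) (i j v : ℕ) : upd2 F i j v i j = v := by simp [upd2]

lemma upd2_ne (F : ℕ → ℕ → ℕ) {i j v a b : ℕ} (h : ¬ (a = i ∧ b = j)) :
    upd2 F i j v a b = F a b := by simp [upd2, h]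

/-- A single entry moved from cell `(i,j)` to cell `(k,l)`. -/
def mv (F : ℕ → ℕ → ℕ) (i j k l : ℕ) : ℕ → ℕ → ℕ := upd2 (upd2 F i j 0) k l (F i j)

lemma mv_apply (F : ℕ → ℕ → ℕ) (i j k l a b : ℕ) :
    mv F i j k l a b = if a = k ∧ b = l then F i j else if a = i ∧ b = j then 0 else F a b := by
  simp [mv, upd2]

lemma perf_col {γ : ℕ → ℕ → Prop} {F : ℕ → ℕ → ℕ} (h : IsPerforated γ F) {i j i' j' x y : ℕ}
    (hi : i < i') (hj : j = j') (hx : F i j = x) (hy : F i' j' = y) (nx : x ≠ 0) (ny : y ≠ 0) :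
    x < y := by
  subst hj hx hy; exact h.2.1 _ _ _ hi nx ny

lemma perf_nw {γ : ℕ → ℕ → Prop} {F : ℕ → ℕ → ℕ} (h : IsPerforated γ F) {i j i' j' x y : ℕ}
    (hi : i ≤ i') (hj : j ≤ j') (hx : F i j = x) (hy : F i' j' = y) (nx : x ≠ 0) (ny : y ≠ 0) :
    x ≤ y := by
  subst hx hy; exact h.2.2 _ _ _ _ hi hj nx ny

lemma arith_comm_col {x y a1 a2 a1' a2' b1 b2 b1' b2' : ℕ}
    (nB : ¬ (a1' = b1 ∧ a2' = b2)) (nA : ¬ (b1' = a1 ∧ b2' = a2))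
    (u1 : a1' < b1 → a2' = b2 → x < y)
    (v1 : a1 < b1' → a2 = b2' → x < y)
    (w1 : a1 < b1 → a2 = b2 → x < y)
    (mA : (a1' = a1 ∧ a2' = a2 + 1) ∨ (a1' = a1 + 1 ∧ a2' = a2) ∨
      (a1 = a1' ∧ a2 = a2' + 1) ∨ (a1 = a1' + 1 ∧ a2 = a2'))
    (mB : (b1' = b1 ∧ b2' = b2 + 1 ∧ (a1 ≤ a1' ∧ a2 ≤ a2')) ∨
      (b1' = b1 + 1 ∧ b2' = b2 ∧ (a1 ≤ a1' ∧ a2 ≤ a2')) ∨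
      (b1 = b1' ∧ b2 = b2' + 1 ∧ (a1' ≤ a1 ∧ a2' ≤ a2)) ∨
      (b1 = b1' + 1 ∧ b2 = b2' ∧ (a1' ≤ a1 ∧ a2' ≤ a2)))
    (h : a1' < b1') (h' : a2' = b2') : x < y := by
  rcases mA with ⟨rfl, rfl⟩ | ⟨rfl, rfl⟩ | ⟨rfl, rfl⟩ | ⟨rfl, rfl⟩ <;>
  rcases mB with ⟨rfl, rfl, _⟩ | ⟨rfl, rfl, _⟩ | ⟨rfl, rfl, _⟩ | ⟨rfl, rfl, _⟩ <;>
  first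
  | (exfalso; omega)
  | exact u1 (by omega) (by omega)
  | exact v1 (by omega) (by omega)
  | exact w1 (by omega) (by omega)

lemma perf_comm {γ : ℕ → ℕ → Prop} {F G1 G2 G : ℕ → ℕ → ℕ} {a1 a2 a1' a2' b1 b2 b1' b2' : ℕ}
    (hA : F a1 a2 ≠ 0) (hB : F b1 b2 ≠ 0) (hA' : F a1' a2' = 0) (hB' : F b1' b2' = 0)
    (hAB : ¬ (a1 = b1 ∧ a2 = b2)) (hAB' : ¬ (a1' = b1' ∧ a2' = b2'))
    (hG1 : G1 = mv F a1 a2 a1' a2') (hG2 : G2 = mv F b1 b2 b1' b2')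
    (hG : G = mv G1 b1 b2 b1' b2')
    (hF : IsPerforated γ F) (h1 : IsPerforated γ G1) (h2 : IsPerforated γ G2)
    (mA : (a1' = a1 ∧ a2' = a2 + 1) ∨ (a1' = a1 + 1 ∧ a2' = a2) ∨
      (a1 = a1' ∧ a2 = a2' + 1) ∨ (a1 = a1' + 1 ∧ a2 = a2'))
    (mB : (b1' = b1 ∧ b2' = b2 + 1 ∧ (a1 ≤ a1' ∧ a2 ≤ a2')) ∨
      (b1' = b1 + 1 ∧ b2' = b2 ∧ (a1 ≤ a1' ∧ a2 ≤ a2')) ∨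
      (b1 = b1' ∧ b2 = b2' + 1 ∧ (a1' ≤ a1 ∧ a2' ≤ a2)) ∨
      (b1 = b1' + 1 ∧ b2 = b2' ∧ (a1' ≤ a1 ∧ a2' ≤ a2))) :
    IsPerforated γ G := by
  have e1 : ∀ a b, G1 a b = if a = a1' ∧ b = a2' then F a1 a2 else
      if a = a1 ∧ b = a2 then 0 else F a b := by intro a b; rw [hG1, mv_apply]
  have e2 : ∀ a b, G2 a b = if a = b1' ∧ b = b2' then F b1 b2 else
      if a = b1 ∧ b = b2 then 0 else F a b := by intro a b; rw [hG2, mv_apply]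
  have e : ∀ a b, G a b = if a = b1' ∧ b = b2' then F b1 b2 else
      if a = b1 ∧ b = b2 then 0 else G1 a b := by
    intro a b; rw [hG, mv_apply, e1 b1 b2]
    have x1 : ¬ (b1 = a1' ∧ b2 = a2') := by rintro ⟨rfl, rfl⟩; exact hB hA'
    have x2 : ¬ (b1 = a1 ∧ b2 = a2) := fun h => hAB ⟨h.1.symm, h.2.symm⟩
    simp [x1, x2]
  have nA : ¬ (b1' = a1 ∧ b2' = a2) := by rintro ⟨rfl, rfl⟩; exact hA hB'
  have nB : ¬ (a1' = b1 ∧ a2' = b2) := by rintro ⟨rfl, rfl⟩; exact hB hA'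
  have r1 : ∀ a b, G a b ≠ 0 → ¬ (a = b1' ∧ b = b2') → G a b = G1 a b := by
    intro a b h h'
    have t := e a b
    rw [if_neg h'] at t
    by_cases hb : a = b1 ∧ b = b2
    · rw [if_pos hb] at t; exact absurd t h
    · rw [if_neg hb] at t; exact t
  have r2 : ∀ a b, G a b ≠ 0 → ¬ (a = a1' ∧ b = a2') → G a b = G2 a b := by
    intro a b h h'
    by_cases hc : a = b1' ∧ b = b2'
    · rw [e, e2, if_pos hc, if_pos hc]
    · have t := r1 a b h hc
      rw [e1, if_neg h'] at t
      by_cases hb : a = a1 ∧ b = a2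
      · rw [if_pos hb] at t; exact absurd t h
      · rw [if_neg hb] at t
        rw [e2, if_neg hc]
        by_cases hb : a = b1 ∧ b = b2
        · rw [e, if_neg hc, if_pos hb] at h; exact absurd rfl h
        · rw [if_neg hb]; exact t
  have g1A' : G1 a1' a2' = F a1 a2 := by rw [e1]; simp
  have g1B : G1 b1 b2 = F b1 b2 := by
    rw [e1, if_neg (fun h => nB ⟨h.1.symm, h.2.symm⟩), if_neg (fun h => hAB ⟨h.1.symm, h.2.symm⟩)]
  have g2B' : G2 b1' b2' = F b1 b2 := by rw [e2]; simp
  have g2A : G2 a1 a2 = F a1 a2 := by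
    rw [e2, if_neg (fun h => nA ⟨h.1.symm, h.2.symm⟩), if_neg hAB]
  have vB : G b1' b2' = F b1 b2 := by rw [e]; simp
  have vA : G a1' a2' = F a1 a2 := by rw [e, if_neg hAB', if_neg nB, g1A']
  clear e e1 e2 hG hG1 hG2
  have mA' := mA
  have mB' := mB
  have c1 : a1' < b1' → a2' = b2' → F a1 a2 < F b1 b2 :=
    arith_comm_col nB nA (fun h h' => perf_col h1 h h' g1A' g1B hA hB)
      (fun h h' => perf_col h2 h h' g2A g2B' hA hB)
      (fun h h' => perf_col hF h h' rfl rfl hA hB) mA mB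
  have c2 : b1' < a1' → b2' = a2' → F b1 b2 < F a1 a2 :=
    arith_comm_col nA nB (fun h h' => perf_col h2 h h' g2B' g2A hB hA)
      (fun h h' => perf_col h1 h h' g1B g1A' hB hA)
      (fun h h' => perf_col hF h h' rfl rfl hB hA)
      (by omega) (by clear * - mA mB; omega)
  have c3 : a1' ≤ b1' → a2' ≤ b2' → F a1 a2 ≤ F b1 b2 := by
    intro h h'
    have : (a1 ≤ a1' ∧ a2 ≤ a2') ∨ (b1' ≤ b1 ∧ b2' ≤ b2) := by clear * - mB; omega
    rcases this with k | k
    · exact perf_nw h2 (k.1.trans h) (k.2.trans h') g2A g2B' hA hB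
    · exact perf_nw h1 (h.trans k.1) (h'.trans k.2) g1A' g1B hA hB
  have c4 : b1' ≤ a1' → b2' ≤ a2' → F b1 b2 ≤ F a1 a2 := by
    intro h h'
    have : (b1 ≤ b1' ∧ b2 ≤ b2') ∨ (a1' ≤ a1 ∧ a2' ≤ a2) := by clear * - mB; omega
    rcases this with k | k
    · exact perf_nw h1 (k.1.trans h) (k.2.trans h') g1B g1A' hB hA
    · exact perf_nw h2 (h.trans k.1) (h'.trans k.2) g2B' g2A hB hA
  obtain ⟨p1, p2, p3⟩ := h1
  obtain ⟨q1, q2, q3⟩ := h2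
  clear mA mB mA' mB' hF
  refine ⟨?_, ?_, ?_⟩
  · intro i j h
    by_cases hc : i = b1' ∧ j = b2'
    · obtain ⟨rfl, rfl⟩ := hc; exact q1 _ _ (by rw [g2B']; exact hB)
    · exact p1 _ _ (by rw [← r1 i j h hc]; exact h)
  · intro i i' j hlt h h'
    by_cases hx : ¬ (i = b1' ∧ j = b2') ∧ ¬ (i' = b1' ∧ j = b2')
    · have t := p2 i i' j hlt
      rw [← r1 i j h hx.1, ← r1 i' j h' hx.2] at t
      exact t h h'
    by_cases hy : ¬ (i = a1' ∧ j = a2') ∧ ¬ (i' = a1' ∧ j = a2')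
    · have t := q2 i i' j hlt
      rw [← r2 i j h hy.1, ← r2 i' j h' hy.2] at t
      exact t h h'
    by_cases hz : i = b1' ∧ j = b2'
    · have hz' : i' = a1' ∧ j = a2' := by omega
      have e3 : G i j = F b1 b2 := by rw [hz.1, hz.2]; exact vB
      have e4 : G i' j = F a1 a2 := by rw [hz'.1, hz'.2]; exact vA
      omega
    · have hz : i' = b1' ∧ j = b2' := by omega
      have hz' : i = a1' ∧ j = a2' := by omega
      have e3 : G i' j = F b1 b2 := by rw [hz.1, hz.2]; exact vB
      have e4 : G i j = F a1 a2 := by rw [hz'.1, hz'.2]; exact vA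
      omega
  · intro i j i' j' hi hj h' h
    by_cases hx : ¬ (i = b1' ∧ j = b2') ∧ ¬ (i' = b1' ∧ j' = b2')
    · have t := p3 i j i' j' hi hj
      rw [← r1 i j h hx.1, ← r1 i' j' h' hx.2] at t
      exact t h' h
    by_cases hy : ¬ (i = a1' ∧ j = a2') ∧ ¬ (i' = a1' ∧ j' = a2')
    · have t := q3 i j i' j' hi hj
      rw [← r2 i j h hy.1, ← r2 i' j' h' hy.2] at t
      exact t h' h
    by_cases hz : i = b1' ∧ j = b2'
    · by_cases hz'' : i' = b1' ∧ j' = b2'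
      · rw [hz.1, hz.2, hz''.1, hz''.2]
      have hz' : i' = a1' ∧ j' = a2' := by omega
      have e3 : G i j = F b1 b2 := by rw [hz.1, hz.2]; exact vB
      have e4 : G i' j' = F a1 a2 := by rw [hz'.1, hz'.2]; exact vA
      omega
    · have hz : i' = b1' ∧ j' = b2' := by omega
      have hz' : i = a1' ∧ j = a2' := by omega
      have e3 : G i' j' = F b1 b2 := by rw [hz.1, hz.2]; exact vB
      have e4 : G i j = F a1 a2 := by rw [hz'.1, hz'.2]; exact vA
      omega

/-- Perforated pairs. -/
def PP (γ : ℕ → ℕ → Prop) (p : (ℕ → ℕ → ℕ) × (ℕ → ℕ → ℕ)) : Prop :=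
  Disj p ∧ IsPerforated γ p.1 ∧ IsPerforated γ p.2

/-- The pair obtained by interchanging the `S`-entry at `(i,j)` with the `T`-entry at `(k,l)`. -/
def sw (p : (ℕ → ℕ → ℕ) × (ℕ → ℕ → ℕ)) (i j k l : ℕ) : (ℕ → ℕ → ℕ) × (ℕ → ℕ → ℕ) :=
  (mv p.1 i j k l, mv p.2 k l i j)

lemma step_iff {γ : ℕ → ℕ → Prop} {p q : (ℕ → ℕ → ℕ) × (ℕ → ℕ → ℕ)} :
    SwitchStep γ p q ↔ ∃ i j k l, p.1 i j ≠ 0 ∧ p.2 k l ≠ 0 ∧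
      ((k = i ∧ l = j + 1) ∨ (k = i + 1 ∧ l = j)) ∧ q = sw p i j k l ∧
      IsPerforated γ q.1 ∧ IsPerforated γ q.2 := by
  constructor
  · rintro ⟨i, j, k, l, h1, h2, h3, h4, h5, h6, h7⟩
    exact ⟨i, j, k, l, h1, h2, h3, Prod.ext h4 h5, h6, h7⟩
  · rintro ⟨i, j, k, l, h1, h2, h3, rfl, h6, h7⟩
    exact ⟨i, j, k, l, h1, h2, h3, rfl, rfl, h6, h7⟩

lemma disj_sw {p : (ℕ → ℕ → ℕ) × (ℕ → ℕ → ℕ)} {i j k l : ℕ} (h : Disj p)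
    (h1 : p.1 i j ≠ 0) (h2 : p.2 k l ≠ 0) : Disj (sw p i j k l) := by
  intro a b
  have := h a b
  have := h i j
  have := h k l
  simp only [sw, mv_apply]
  by_cases c1 : a = i ∧ b = j
  · by_cases c2 : a = k ∧ b = l
    · grind
    · simp [c1, c2]; grind
  · by_cases c2 : a = k ∧ b = l
    · simp [c1, c2]; grind
    · simp [c1, c2]; grind

lemma pp_step {γ : ℕ → ℕ → Prop} {p q : (ℕ → ℕ → ℕ) × (ℕ → ℕ → ℕ)} (hp : PP γ p)
    (h : SwitchStep γ p q) : PP γ q := by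
  obtain ⟨i, j, k, l, h1, h2, h3, rfl, h6, h7⟩ := step_iff.1 h
  exact ⟨disj_sw hp.1 h1 h2, h6, h7⟩

lemma mv_comm {F : ℕ → ℕ → ℕ} {a1 a2 a1' a2' b1 b2 b1' b2' : ℕ}
    (hA : F a1 a2 ≠ 0) (hB : F b1 b2 ≠ 0) (hA' : F a1' a2' = 0) (hB' : F b1' b2' = 0)
    (hAB : ¬ (a1 = b1 ∧ a2 = b2)) (hAB' : ¬ (a1' = b1' ∧ a2' = b2')) :
    mv (mv F a1 a2 a1' a2') b1 b2 b1' b2' = mv (mv F b1 b2 b1' b2') a1 a2 a1' a2' := by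
  have nA : ¬ (b1' = a1 ∧ b2' = a2) := by rintro ⟨rfl, rfl⟩; exact hA hB'
  have nB : ¬ (a1' = b1 ∧ a2' = b2) := by rintro ⟨rfl, rfl⟩; exact hB hA'
  have nA' : ¬ (a1 = b1' ∧ a2 = b2') := by rintro ⟨rfl, rfl⟩; exact hA hB'
  have nB' : ¬ (b1 = a1' ∧ b2 = a2') := by rintro ⟨rfl, rfl⟩; exact hB hA'
  have hBA : ¬ (b1 = a1 ∧ b2 = a2) := fun h => hAB ⟨h.1.symm, h.2.symm⟩
  have hBA' : ¬ (b1' = a1' ∧ b2' = a2') := fun h => hAB' ⟨h.1.symm, h.2.symm⟩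
  funext x y
  simp only [mv_apply, if_neg nA', if_neg nB', if_neg hAB, if_neg hBA]
  by_cases c1 : x = a1' ∧ y = a2'
  · obtain ⟨rfl, rfl⟩ := c1; simp [hAB', nB]
  by_cases c2 : x = b1' ∧ y = b2'
  · obtain ⟨rfl, rfl⟩ := c2; simp [hBA', nA]
  simp only [if_neg c1, if_neg c2]
  split_ifs <;> rfl

lemma diamond_s {γ : ℕ → ℕ → Prop} {p : (ℕ → ℕ → ℕ) × (ℕ → ℕ → ℕ)} {a1 a2 a1' a2' b1' b2' : ℕ}
    (t1 : p.2 a1' a2' ≠ 0) (t2 : p.2 b1' b2' ≠ 0)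
    (m1 : (a1' = a1 ∧ a2' = a2 + 1) ∨ (a1' = a1 + 1 ∧ a2' = a2))
    (m2 : (b1' = a1 ∧ b2' = a2 + 1) ∨ (b1' = a1 + 1 ∧ b2' = a2))
    (q2 : IsPerforated γ (sw p a1 a2 a1' a2').2) (r2 : IsPerforated γ (sw p a1 a2 b1' b2').2)
    (hAB' : ¬ (a1' = b1' ∧ a2' = b2')) : False := by
  have f1 : (sw p a1 a2 a1' a2').2 a1 a2 = p.2 a1' a2' := by simp [sw, mv_apply]
  have f2 : (sw p a1 a2 a1' a2').2 b1' b2' = p.2 b1' b2' := by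
    simp only [sw, mv_apply]; rw [if_neg (by omega), if_neg (by omega)]
  have f3 : (sw p a1 a2 b1' b2').2 a1 a2 = p.2 b1' b2' := by simp [sw, mv_apply]
  have f4 : (sw p a1 a2 b1' b2').2 a1' a2' = p.2 a1' a2' := by
    simp only [sw, mv_apply]; rw [if_neg (by omega), if_neg (by omega)]
  have k3 := perf_nw q2 (by omega) (by omega) f1 f2 t1 t2
  have k4 := perf_nw r2 (by omega) (by omega) f3 f4 t2 t1
  rcases m1 with ⟨e1, e2⟩ | ⟨e1, e2⟩ <;> rcases m2 with ⟨e3, e4⟩ | ⟨e3, e4⟩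
  · omega
  · have := perf_col q2 (by omega) e4.symm f1 f2 t1 t2; omega
  · have := perf_col r2 (by omega) e2.symm f3 f4 t2 t1; omega
  · omega

lemma diamond_t {γ : ℕ → ℕ → Prop} {p : (ℕ → ℕ → ℕ) × (ℕ → ℕ → ℕ)} {a1 a2 b1 b2 a1' a2' : ℕ}
    (s1 : p.1 a1 a2 ≠ 0) (s2 : p.1 b1 b2 ≠ 0)
    (m1 : (a1' = a1 ∧ a2' = a2 + 1) ∨ (a1' = a1 + 1 ∧ a2' = a2))
    (m2 : (a1' = b1 ∧ a2' = b2 + 1) ∨ (a1' = b1 + 1 ∧ a2' = b2))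
    (q1 : IsPerforated γ (sw p a1 a2 a1' a2').1) (r1 : IsPerforated γ (sw p b1 b2 a1' a2').1)
    (hAB : ¬ (a1 = b1 ∧ a2 = b2)) : False := by
  have f1 : (sw p a1 a2 a1' a2').1 a1' a2' = p.1 a1 a2 := by simp [sw, mv_apply]
  have f2 : (sw p a1 a2 a1' a2').1 b1 b2 = p.1 b1 b2 := by
    simp only [sw, mv_apply]; rw [if_neg (by omega), if_neg (by omega)]
  have f3 : (sw p b1 b2 a1' a2').1 a1' a2' = p.1 b1 b2 := by simp [sw, mv_apply]
  have f4 : (sw p b1 b2 a1' a2').1 a1 a2 = p.1 a1 a2 := by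
    simp only [sw, mv_apply]; rw [if_neg (by omega), if_neg (by omega)]
  have k3 := perf_nw q1 (by omega) (by omega) f2 f1 s2 s1
  have k4 := perf_nw r1 (by omega) (by omega) f4 f3 s1 s2
  rcases m1 with ⟨e1, e2⟩ | ⟨e1, e2⟩ <;> rcases m2 with ⟨e3, e4⟩ | ⟨e3, e4⟩
  · omega
  · have := perf_col q1 (by omega) e4.symm f2 f1 s2 s1; omega
  · have := perf_col r1 (by omega) e2.symm f4 f3 s1 s2; omega
  · omega

lemma diamond {γ : ℕ → ℕ → Prop} {p q r : (ℕ → ℕ → ℕ) × (ℕ → ℕ → ℕ)} (hp : PP γ p)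
    (hq : SwitchStep γ p q) (hr : SwitchStep γ p r) :
    q = r ∨ ∃ d, SwitchStep γ q d ∧ SwitchStep γ r d := by
  obtain ⟨a1, a2, a1', a2', s1, t1, m1, rfl, q1, q2⟩ := step_iff.1 hq
  obtain ⟨b1, b2, b1', b2', s2, t2, m2, rfl, r1, r2⟩ := step_iff.1 hr
  have dj := hp.1
  have zA := (dj a1 a2).resolve_left s1
  have zB := (dj b1 b2).resolve_left s2
  have zA' := (dj a1' a2').resolve_right t1
  have zB' := (dj b1' b2').resolve_right t2
  by_cases hAB : a1 = b1 ∧ a2 = b2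
  · obtain ⟨rfl, rfl⟩ := hAB
    by_cases hAB' : a1' = b1' ∧ a2' = b2'
    · obtain ⟨rfl, rfl⟩ := hAB'; exact Or.inl rfl
    · exact (diamond_s t1 t2 m1 m2 q2 r2 hAB').elim
  by_cases hAB' : a1' = b1' ∧ a2' = b2'
  · obtain ⟨rfl, rfl⟩ := hAB'
    exact (diamond_t s1 s2 m1 m2 q1 r1 hAB).elim
  right
  have hBA : ¬ (b1 = a1 ∧ b2 = a2) := fun h => hAB ⟨h.1.symm, h.2.symm⟩
  have hBA' : ¬ (b1' = a1' ∧ b2' = a2') := fun h => hAB' ⟨h.1.symm, h.2.symm⟩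
  have g1 : (sw p a1 a2 a1' a2').1 b1 b2 ≠ 0 := by
    simp only [sw, mv_apply]; rw [if_neg, if_neg hBA]
    · exact s2
    · rintro ⟨rfl, rfl⟩; exact s2 zA'
  have g2 : (sw p a1 a2 a1' a2').2 b1' b2' ≠ 0 := by
    simp only [sw, mv_apply]; rw [if_neg, if_neg hBA']
    · exact t2
    · rintro ⟨rfl, rfl⟩; exact t2 zA
  have g3 : (sw p b1 b2 b1' b2').1 a1 a2 ≠ 0 := by
    simp only [sw, mv_apply]; rw [if_neg, if_neg hAB]
    · exact s1
    · rintro ⟨rfl, rfl⟩; exact s1 zB'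
  have g4 : (sw p b1 b2 b1' b2').2 a1' a2' ≠ 0 := by
    simp only [sw, mv_apply]; rw [if_neg, if_neg hAB']
    · exact t1
    · rintro ⟨rfl, rfl⟩; exact t1 zB
  have P1 : IsPerforated γ (sw (sw p a1 a2 a1' a2') b1 b2 b1' b2').1 :=
    perf_comm s1 s2 zA' zB' hAB hAB' rfl rfl rfl hp.2.1 q1 r1 (by clear * - m1; omega) (by clear * - m1 m2; omega)
  have P2 : IsPerforated γ (sw (sw p a1 a2 a1' a2') b1 b2 b1' b2').2 :=
    perf_comm t1 t2 zA zB hAB' hAB rfl rfl rfl hp.2.2 q2 r2 (by clear * - m1; omega) (by clear * - m1 m2; omega)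
  refine ⟨sw (sw p a1 a2 a1' a2') b1 b2 b1' b2', ?_, ?_⟩
  · exact step_iff.2 ⟨b1, b2, b1', b2', g1, g2, m2, rfl, P1, P2⟩
  · exact step_iff.2 ⟨a1, a2, a1', a2', g3, g4, m1,
      Prod.ext (mv_comm s1 s2 zA' zB' hAB hAB') (mv_comm t1 t2 zA zB hAB' hAB), P1, P2⟩

/-- Terminal configurations are unique. -/
lemma terminal_unique {γ : ℕ → ℕ → Prop} {p c d : (ℕ → ℕ → ℕ) × (ℕ → ℕ → ℕ)} (hp : PP γ p)
    (hc : Relation.ReflTransGen (SwitchStep γ) p c) (hd : Relation.ReflTransGen (SwitchStep γ) p d)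
    (tc : ∀ q, ¬ SwitchStep γ c q) (td : ∀ q, ¬ SwitchStep γ d q) : c = d := by
  let R : (ℕ → ℕ → ℕ) × (ℕ → ℕ → ℕ) → (ℕ → ℕ → ℕ) × (ℕ → ℕ → ℕ) → Prop :=
    fun a b => PP γ a ∧ SwitchStep γ a b
  have lift : ∀ x, Relation.ReflTransGen (SwitchStep γ) p x →
      Relation.ReflTransGen R p x ∧ PP γ x := by
    intro x hx
    induction hx with
    | refl => exact ⟨.refl, hp⟩
    | tail _ hs ih => exact ⟨ih.1.tail ⟨ih.2, hs⟩, pp_step ih.2 hs⟩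
  have key := Relation.church_rosser (r := R) (fun a b c hab hac => by
    rcases diamond hab.1 hab.2 hac.2 with rfl | ⟨d, h1, h2⟩
    · exact ⟨b, .refl, .refl⟩
    · exact ⟨d, .single ⟨pp_step hab.1 hab.2, h1⟩, .single ⟨pp_step hac.1 hac.2, h2⟩⟩)
    (lift c hc).1 (lift d hd).1
  obtain ⟨e, h1, h2⟩ := key
  have n : ∀ x, (∀ q, ¬ SwitchStep γ x q) → Relation.ReflTransGen R x e → x = e := by
    intro x hx hxe
    rcases Relation.ReflTransGen.cases_head hxe with h | ⟨y, hy, _⟩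
    · exact h
    · exact absurd hy.2 (hx y)
  rw [n c tc h1, n d td h2]


/-- Pairs in which all interchanges allowed by `Φ` have been carried out, and those for the
pair of letters `(a, b)` have possibly been started. -/
structure SG (γ : ℕ → ℕ → Prop) (A B : ℕ) (Φ : ℕ → ℕ → Prop) (a b : ℕ)
    (p : (ℕ → ℕ → ℕ) × (ℕ → ℕ → ℕ)) : Prop where
  pf1 : IsPerforated γ p.1
  pf2 : IsPerforated γ p.2
  dj : Disj p
  fill : ∀ i j, γ i j → p.1 i j ≠ 0 ∨ p.2 i j ≠ 0
  bd1 : ∀ i j, p.1 i j ≤ A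
  bd2 : ∀ i j, p.2 i j ≤ B
  st : ∀ i j k l, i ≤ k → j ≤ l → p.1 i j ≠ 0 → p.2 k l ≠ 0 →
    (p.1 i j = a ∧ p.2 k l = b) ∨ ¬ Φ (p.1 i j) (p.2 k l)
  ts : ∀ i j k l, i ≤ k → j ≤ l → p.2 i j ≠ 0 → p.1 k l ≠ 0 →
    (p.1 k l = a ∧ p.2 i j = b) ∨ Φ (p.1 k l) (p.2 i j)

/-- Order convexity of a shape. -/
def Cvx (γ : ℕ → ℕ → Prop) : Prop :=
  ∀ i j k l m n, γ i j → γ k l → i ≤ m → m ≤ k → j ≤ n → n ≤ l → γ m n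

section
variable {γ Φ : ℕ → ℕ → Prop} {A B a b : ℕ} {p : (ℕ → ℕ → ℕ) × (ℕ → ℕ → ℕ)}

/-- An `S`-entry weakly northwest of a `b` is at most `a`. -/
lemma SG.le_a (h : SG γ A B Φ a b p) (C1 : ∀ a', a < a' → a' ≤ A → Φ a' b)
    {i j k l : ℕ} (hi : i ≤ k) (hj : j ≤ l) (h1 : p.1 i j ≠ 0) (h2 : p.2 k l = b) (hb : b ≠ 0) :
    p.1 i j ≤ a := by
  by_contra hlt
  rcases h.st i j k l hi hj h1 (by rw [h2]; exact hb) with h3 | h3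
  · omega
  · rw [h2] at h3; exact h3 (C1 _ (by omega) (h.bd1 _ _))

/-- A `T`-entry weakly southeast of an `a` is at least `b`. -/
lemma SG.ge_b (h : SG γ A B Φ a b p) (C2 : ∀ b', b' ≠ 0 → b' < b → Φ a b')
    {i j k l : ℕ} (hi : i ≤ k) (hj : j ≤ l) (h1 : p.1 i j = a) (ha : a ≠ 0) (h2 : p.2 k l ≠ 0) :
    b ≤ p.2 k l := by
  by_contra hlt
  rcases h.st i j k l hi hj (by rw [h1]; exact ha) h2 with h3 | h3
  · omega
  · rw [h1] at h3; exact h3 (C2 _ h2 (by omega))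

lemma SG.adj (h : SG γ A B Φ a b p) (hc : Cvx γ) (C1 : ∀ a', a < a' → a' ≤ A → Φ a' b)
    (C2 : ∀ b', b' ≠ 0 → b' < b → Φ a b') (ha : a ≠ 0) (hb : b ≠ 0) :
    ∀ n i j k l, k - i + (l - j) = n → i ≤ k → j ≤ l → p.1 i j = a → p.2 k l = b →
      (∃ m n, p.1 m n = a ∧ p.2 (m + 1) n = b) ∨
      (j < l ∧ ∃ m n, p.1 m n = a ∧ p.2 m (n + 1) = b) := by
  intro n
  induction n with
  | zero =>
    intro i j k l hn hi hj h1 h2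
    have e1 : k = i := by omega
    have e2 : l = j := by omega
    subst e1 e2
    have := h.dj k l
    omega
  | succ n ih =>
    intro i j k l hn hi hj h1 h2
    have key : ∀ m n, i ≤ m → m ≤ k → j ≤ n → n ≤ l → p.1 m n = a ∨ p.2 m n = b := by
      intro m n g1 g2 g3 g4
      have hγ := hc i j k l m n (h.pf1.1 _ _ (by omega)) (h.pf2.1 _ _ (by omega)) g1 g2 g3 g4
      rcases h.fill m n hγ with h3 | h3
      · left
        have := h.le_a C1 g2 g4 h3 h2 hb
        have := perf_nw h.pf1 g1 g3 h1 rfl ha h3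
        omega
      · right
        have := h.ge_b C2 g1 g3 h1 ha h3
        have := perf_nw h.pf2 g2 g4 rfl h2 h3 hb
        omega
    by_cases hik : i < k
    · rcases key (i + 1) j (by omega) (by omega) (by omega) (by omega) with h3 | h3
      · exact ih (i + 1) j k l (by omega) (by omega) (by omega) h3 h2
      · exact Or.inl ⟨i, j, h1, h3⟩
    · rcases key i (j + 1) (by omega) (by omega) (by omega) (by omega) with h3 | h3
      · rcases ih i (j + 1) k l (by omega) (by omega) (by omega) h3 h2 with h4 | ⟨-, h4⟩
        · exact Or.inl h4
        · exact Or.inr ⟨by omega, h4⟩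
      · exact Or.inr ⟨by omega, i, j, h1, h3⟩

lemma sw1_apply (p : (ℕ → ℕ → ℕ) × (ℕ → ℕ → ℕ)) (i j k l x y : ℕ) :
    (sw p i j k l).1 x y = if x = k ∧ y = l then p.1 i j else
      if x = i ∧ y = j then 0 else p.1 x y := mv_apply _ _ _ _ _ _ _

lemma sw2_apply (p : (ℕ → ℕ → ℕ) × (ℕ → ℕ → ℕ)) (i j k l x y : ℕ) :
    (sw p i j k l).2 x y = if x = i ∧ y = j then p.2 k l else
      if x = k ∧ y = l then 0 else p.2 x y := mv_apply _ _ _ _ _ _ _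

/-- Description of the nonzero entries after a move. -/
lemma mv_ne {F : ℕ → ℕ → ℕ} {i j k l x y : ℕ} (h : mv F i j k l x y ≠ 0) :
    (x = k ∧ y = l ∧ mv F i j k l x y = F i j) ∨
    (¬ (x = k ∧ y = l) ∧ ¬ (x = i ∧ y = j) ∧ mv F i j k l x y = F x y) := by
  rw [mv_apply] at *
  split_ifs at * with h1 h2
  · exact Or.inl ⟨h1.1, h1.2, rfl⟩
  · exact absurd rfl h
  · exact Or.inr ⟨h1, h2, rfl⟩

lemma SG.sw_good (h : SG γ A B Φ a b p) (C1 : ∀ a', a < a' → a' ≤ A → Φ a' b)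
    (C2 : ∀ b', b' ≠ 0 → b' < b → Φ a b') (ha : a ≠ 0) (hb : b ≠ 0) {i j k l : ℕ}
    (hm : (k = i ∧ l = j + 1) ∨ (k = i + 1 ∧ l = j)) (h1 : p.1 i j = a) (h2 : p.2 k l = b)
    (q1 : IsPerforated γ (sw p i j k l).1) (q2 : IsPerforated γ (sw p i j k l).2) :
    SG γ A B Φ a b (sw p i j k l) := by
  refine ⟨q1, q2, disj_sw h.dj (by omega) (by omega), ?_, ?_, ?_, ?_, ?_⟩
  · intro x y hxy
    rw [sw1_apply, sw2_apply]
    by_cases c1 : x = i ∧ y = j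
    · right; rw [if_pos c1]; omega
    · by_cases c2 : x = k ∧ y = l
      · left; rw [if_pos c2]; omega
      · rw [if_neg c1, if_neg c2, if_neg c1, if_neg c2]; exact h.fill x y hxy
  · intro x y; rw [sw1_apply]
    have := h.bd1 i j; have := h.bd1 x y
    split_ifs <;> omega
  · intro x y; rw [sw2_apply]
    have := h.bd2 k l; have := h.bd2 x y
    split_ifs <;> omega
  · intro x y z w hxz hyw n1 n2
    rcases mv_ne n1 with ⟨e1, e2, e3⟩ | ⟨e1, e2, e3⟩ <;>
    rcases mv_ne n2 with ⟨f1, f2, f3⟩ | ⟨f1, f2, f3⟩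
    · omega
    · have e3' : (sw p i j k l).1 x y = p.1 i j := e3
      have f3' : (sw p i j k l).2 z w = p.2 z w := f3
      rw [e3'] at n1 ⊢; rw [f3'] at n2 ⊢
      exact h.st i j z w (by omega) (by omega) n1 n2
    · have e3' : (sw p i j k l).1 x y = p.1 x y := e3
      have f3' : (sw p i j k l).2 z w = p.2 k l := f3
      rw [e3'] at n1 ⊢; rw [f3'] at n2 ⊢
      exact h.st x y k l (by omega) (by omega) n1 n2
    · have e3' : (sw p i j k l).1 x y = p.1 x y := e3
      have f3' : (sw p i j k l).2 z w = p.2 z w := f3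
      rw [e3'] at n1 ⊢; rw [f3'] at n2 ⊢
      exact h.st x y z w (by omega) (by omega) n1 n2
  · intro x y z w hxz hyw n2 n1
    rcases mv_ne n1 with ⟨e1, e2, e3⟩ | ⟨e1, e2, e3⟩ <;>
    rcases mv_ne n2 with ⟨f1, f2, f3⟩ | ⟨f1, f2, f3⟩
    · have e3' : (sw p i j k l).1 z w = p.1 i j := e3
      have f3' : (sw p i j k l).2 x y = p.2 k l := f3
      rw [e3', f3']; exact Or.inl ⟨h1, h2⟩
    · have e3' : (sw p i j k l).1 z w = p.1 i j := e3
      have f3' : (sw p i j k l).2 x y = p.2 x y := f3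
      rw [e3'] at n1 ⊢; rw [f3'] at n2 ⊢
      have := perf_nw h.pf2 (by omega) (by omega) rfl h2 n2 hb
      rcases Nat.lt_or_eq_of_le this with g | g
      · right; rw [h1]; exact C2 _ n2 g
      · exact Or.inl ⟨h1, g⟩
    · have e3' : (sw p i j k l).1 z w = p.1 z w := e3
      have f3' : (sw p i j k l).2 x y = p.2 k l := f3
      rw [e3'] at n1 ⊢; rw [f3'] at n2 ⊢
      have := perf_nw h.pf1 (by omega) (by omega) h1 rfl ha n1
      rcases Nat.lt_or_eq_of_le this with g | g
      · right; rw [h2]; exact C1 _ g (h.bd1 _ _)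
      · exact Or.inl ⟨g.symm, h2⟩
    · have e3' : (sw p i j k l).1 z w = p.1 z w := e3
      have f3' : (sw p i j k l).2 x y = p.2 x y := f3
      rw [e3'] at n1 ⊢; rw [f3'] at n2 ⊢
      exact h.ts x y z w (by omega) (by omega) n2 n1

/-- Criterion for a move to preserve perforatedness. -/
lemma perf_mv {F : ℕ → ℕ → ℕ} {i j k l : ℕ} (hF : IsPerforated γ F)
    (hγ : γ k l)
    (c1 : ∀ x y, ¬ (x = i ∧ y = j) → ¬ (x = k ∧ y = l) → F x y ≠ 0 → x ≤ k → y ≤ l → F x y ≤ F i j)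
    (c2 : ∀ x y, ¬ (x = i ∧ y = j) → ¬ (x = k ∧ y = l) → F x y ≠ 0 → k ≤ x → l ≤ y → F i j ≤ F x y)
    (c3 : ∀ x, ¬ (x = i ∧ l = j) → F x l ≠ 0 → x < k → F x l ≠ F i j)
    (c4 : ∀ x, ¬ (x = i ∧ l = j) → F x l ≠ 0 → k < x → F x l ≠ F i j) :
    IsPerforated γ (mv F i j k l) := by
  refine ⟨?_, ?_, ?_⟩
  · intro x y h
    rcases mv_ne h with ⟨rfl, rfl, e⟩ | ⟨-, -, e⟩
    · exact hγ
    · exact hF.1 _ _ (by rw [← e]; exact h)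
  · intro x x' y hlt n1 n2
    rcases mv_ne n1 with ⟨e1, e2, e3⟩ | ⟨e1, e2, e3⟩ <;>
    rcases mv_ne n2 with ⟨f1, f2, f3⟩ | ⟨f1, f2, f3⟩
    · omega
    · rw [e3] at n1 ⊢; rw [f3] at n2 ⊢
      subst e1 e2
      have g1 := c2 x' y f2 f1 n2 (by omega) le_rfl
      have g2 := c4 x' f2 n2 hlt
      omega
    · rw [e3] at n1 ⊢; rw [f3] at n2 ⊢
      subst f1 f2
      have g1 := c1 x y e2 e1 n1 (by omega) le_rfl
      have g2 := c3 x e2 n1 hlt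
      omega
    · rw [e3] at n1 ⊢; rw [f3] at n2 ⊢
      exact hF.2.1 _ _ _ hlt n1 n2
  · intro x' y' x y hx hy n1 n2
    rcases mv_ne n1 with ⟨e1, e2, e3⟩ | ⟨e1, e2, e3⟩ <;>
    rcases mv_ne n2 with ⟨f1, f2, f3⟩ | ⟨f1, f2, f3⟩
    · rw [e3, f3]
    · rw [e3] at n1 ⊢; rw [f3] at n2 ⊢
      subst e1 e2
      exact c2 x' y' f2 f1 n2 hx hy
    · rw [e3] at n1 ⊢; rw [f3] at n2 ⊢
      subst f1 f2
      exact c1 x y e2 e1 n1 hx hy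
    · rw [e3] at n1 ⊢; rw [f3] at n2 ⊢
      exact hF.2.2 _ _ _ _ hx hy n1 n2

lemma SG.perf_vert (h : SG γ A B Φ a b p) (C1 : ∀ a', a < a' → a' ≤ A → Φ a' b)
    (C2 : ∀ b', b' ≠ 0 → b' < b → Φ a b') (ha : a ≠ 0) (hb : b ≠ 0) {i j : ℕ}
    (h1 : p.1 i j = a) (h2 : p.2 (i + 1) j = b) :
    IsPerforated γ (sw p i j (i + 1) j).1 ∧ IsPerforated γ (sw p i j (i + 1) j).2 := by
  constructor
  · refine perf_mv h.pf1 (h.pf2.1 _ _ (by omega)) ?_ ?_ ?_ ?_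
    · intro x y _ _ n hx hy
      rw [h1]; exact h.le_a C1 hx hy n h2 hb
    · intro x y _ _ n hx hy
      exact perf_nw h.pf1 (by omega) hy rfl rfl (by omega) n
    · intro x e n hx
      have := perf_col h.pf1 (show x < i by omega) rfl rfl h1 n ha
      omega
    · intro x e n hx
      have := perf_col h.pf1 (show i < x by omega) rfl h1 rfl ha n
      omega
  · refine perf_mv h.pf2 (h.pf1.1 _ _ (by omega)) ?_ ?_ ?_ ?_
    · intro x y _ _ n hx hy
      exact perf_nw h.pf2 (by omega) hy rfl rfl n (by omega)
    · intro x y _ _ n hx hy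
      rw [h2]; exact h.ge_b C2 hx hy h1 ha n
    · intro x e n hx
      have := perf_col h.pf2 (show x < i + 1 by omega) rfl rfl h2 n hb
      omega
    · intro x e n hx
      have := perf_col h.pf2 (show i + 1 < x by omega) rfl h2 rfl hb n
      omega

lemma SG.perf_horiz (h : SG γ A B Φ a b p) (hc : Cvx γ) (C1 : ∀ a', a < a' → a' ≤ A → Φ a' b)
    (C2 : ∀ b', b' ≠ 0 → b' < b → Φ a b') (ha : a ≠ 0) (hb : b ≠ 0) {i j : ℕ}
    (h1 : p.1 i j = a) (h2 : p.2 i (j + 1) = b)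
    (nv : ¬ ∃ m n, p.1 m n = a ∧ p.2 (m + 1) n = b) :
    IsPerforated γ (sw p i j i (j + 1)).1 ∧ IsPerforated γ (sw p i j i (j + 1)).2 := by
  have nv' : ∀ m k n, m ≤ k → p.1 m n = a → p.2 k n = b → False := by
    intro m k n hmk g1 g2
    rcases h.adj hc C1 C2 ha hb _ m n k n rfl hmk le_rfl g1 g2 with g | g
    · exact nv g
    · omega
  have γ1 : γ i j := h.pf1.1 _ _ (by omega)
  have γ2 : γ i (j + 1) := h.pf2.1 _ _ (by omega)
  constructor
  · refine perf_mv h.pf1 γ2 ?_ ?_ ?_ ?_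
    · intro x y _ _ n hx hy
      rw [h1]; exact h.le_a C1 hx hy n h2 hb
    · intro x y _ _ n hx hy
      exact perf_nw h.pf1 (by omega) (by omega) rfl rfl (by omega) n
    · intro x e n hx hxa
      exact nv' x i (j + 1) hx.le (by omega) h2
    · intro x e n hx hxa
      have γ3 : γ x (j + 1) := h.pf1.1 _ _ n
      have γ4 : γ x j := hc i j x (j + 1) x j γ1 γ3 hx.le le_rfl le_rfl (by omega)
      rcases h.fill x j γ4 with g | g
      · have := perf_col h.pf1 hx rfl h1 rfl ha g
        have := perf_nw h.pf1 le_rfl (Nat.le_succ j) rfl rfl g n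
        simp only [Nat.succ_eq_add_one] at this
        omega
      · have t1 := h.st i j x j hx.le le_rfl (by omega) g
        have t2 := h.ts x j x (j + 1) le_rfl (by omega) g n
        rw [hxa] at t2
        have : p.2 x j = b := by
          rcases t1 with t1 | t1
          · exact t1.2
          · rcases t2 with t2 | t2
            · exact t2.2
            · exact absurd t2 t1
        exact nv' i x j hx.le h1 this
  · refine perf_mv h.pf2 γ1 ?_ ?_ ?_ ?_
    · intro x y _ _ n hx hy
      exact perf_nw h.pf2 (by omega) (by omega) rfl rfl n (by omega)
    · intro x y _ _ n hx hy
      rw [h2]; exact h.ge_b C2 hx hy h1 ha n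
    · intro x e n hx hxb
      have γ3 : γ x j := h.pf2.1 _ _ n
      have γ4 : γ x (j + 1) := hc x j i (j + 1) x (j + 1) γ3 γ2 le_rfl hx.le (by omega) le_rfl
      rcases h.fill x (j + 1) γ4 with g | g
      · have t1 := h.st x (j + 1) i (j + 1) hx.le le_rfl g (by omega)
        have t2 := h.ts x j x (j + 1) le_rfl (by omega) n g
        rw [hxb] at t2
        have : p.1 x (j + 1) = a := by
          rcases t1 with t1 | t1
          · exact t1.1
          · rcases t2 with t2 | t2
            · exact t2.1
            · exact absurd t2 t1
        exact nv' x i (j + 1) hx.le this h2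
      · have := perf_col h.pf2 hx rfl rfl h2 g hb
        have := perf_nw h.pf2 le_rfl (Nat.le_succ j) rfl rfl n g
        simp only [Nat.succ_eq_add_one] at this
        omega
    · intro x e n hx hxb
      exact nv' i x j hx.le h1 (by omega)

end

/-- The measure used for termination. -/
noncomputable def meas (N : ℕ) (F : ℕ → ℕ → ℕ) : ℕ :=
  ∑ c ∈ (Finset.range N ×ˢ Finset.range N).filter (fun c => F c.1 c.2 ≠ 0), (c.1 + c.2)

lemma meas_lt {γ : ℕ → ℕ → Prop} {N : ℕ} (hN : ∀ i j, γ i j → i < N ∧ j < N) {F : ℕ → ℕ → ℕ}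
    {i j k l : ℕ} (h1 : γ i j) (h2 : γ k l)
    (hm : (k = i ∧ l = j + 1) ∨ (k = i + 1 ∧ l = j)) (g1 : F i j = 0) (g2 : F k l ≠ 0) :
    meas N (mv F k l i j) < meas N F := by
  unfold meas
  have e : (Finset.range N ×ˢ Finset.range N).filter (fun c => mv F k l i j c.1 c.2 ≠ 0) =
      insert (i, j) (((Finset.range N ×ˢ Finset.range N).filter
        (fun c => F c.1 c.2 ≠ 0)).erase (k, l)) := by
    ext ⟨x, y⟩
    have := hN i j h1
    have := hN k l h2
    simp only [Finset.mem_filter, Finset.mem_insert, Finset.mem_erase, Finset.mem_product,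
      Finset.mem_range, mv_apply, Prod.mk.injEq, ne_eq]
    by_cases c1 : x = i ∧ y = j
    · simp only [if_pos c1, c1]; simp; omega
    · by_cases c2 : x = k ∧ y = l
      · simp [if_neg c1, c2]; omega
      · simp [if_neg c1, if_neg c2, c1, c2]
  rw [e, Finset.sum_insert (by simp [g1])]
  have hmem : (k, l) ∈ (Finset.range N ×ˢ Finset.range N).filter (fun c => F c.1 c.2 ≠ 0) := by
    have := hN k l h2
    simp [g2, this.1, this.2]
  rw [← Finset.add_sum_erase _ _ hmem]
  simp only
  omega

lemma run_ab {γ : ℕ → ℕ → Prop} {N A B : ℕ} (hc : Cvx γ) (hN : ∀ i j, γ i j → i < N ∧ j < N)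
    {Φ : ℕ → ℕ → Prop} {a b : ℕ} (C1 : ∀ a', a < a' → a' ≤ A → Φ a' b)
    (C2 : ∀ b', b' ≠ 0 → b' < b → Φ a b') (ha : a ≠ 0) (hb : b ≠ 0)
    (Inv : (ℕ → ℕ → ℕ) × (ℕ → ℕ → ℕ) → Prop)
    (hInv : ∀ p i j k l, SG γ A B Φ a b p → ((k = i ∧ l = j + 1) ∨ (k = i + 1 ∧ l = j)) →
      p.1 i j = a → p.2 k l = b → SG γ A B Φ a b (sw p i j k l) → Inv p → Inv (sw p i j k l)) :
    ∀ n p, meas N p.2 = n → SG γ A B Φ a b p → Inv p →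
      ∃ q, Relation.ReflTransGen (SwitchStep γ) p q ∧ SG γ A B Φ a b q ∧ Inv q ∧
        ∀ i j k l, i ≤ k → j ≤ l → q.1 i j = a → q.2 k l ≠ b := by
  intro n
  induction n using Nat.strong_induction_on with
  | _ n ih =>
  intro p hn hp hI
  have go : ∀ i j k l, ((k = i ∧ l = j + 1) ∨ (k = i + 1 ∧ l = j)) → p.1 i j = a → p.2 k l = b →
      IsPerforated γ (sw p i j k l).1 ∧ IsPerforated γ (sw p i j k l).2 →
      ∃ q, Relation.ReflTransGen (SwitchStep γ) p q ∧ SG γ A B Φ a b q ∧ Inv q ∧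
        ∀ i j k l, i ≤ k → j ≤ l → q.1 i j = a → q.2 k l ≠ b := by
    intro i j k l hm g1 g2 hq
    have hg := hp.sw_good C1 C2 ha hb hm g1 g2 hq.1 hq.2
    have hs : SwitchStep γ p (sw p i j k l) :=
      step_iff.2 ⟨i, j, k, l, by omega, by omega, hm, rfl, hq.1, hq.2⟩
    have hlt : meas N (sw p i j k l).2 < n := by
      rw [← hn]
      refine meas_lt hN (hp.pf1.1 _ _ (by omega)) (hp.pf2.1 _ _ (by omega)) hm ?_ (by omega)
      have := hp.dj i j
      omega
    obtain ⟨q, k1, k2⟩ := ih _ hlt _ rfl hg (hInv p i j k l hp hm g1 g2 hg hI)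
    exact ⟨q, k1.head hs, k2⟩
  by_cases hv : ∃ m n, p.1 m n = a ∧ p.2 (m + 1) n = b
  · obtain ⟨i, j, g1, g2⟩ := hv
    exact go i j (i + 1) j (Or.inr ⟨rfl, rfl⟩) g1 g2 (hp.perf_vert C1 C2 ha hb g1 g2)
  · by_cases hh : ∃ m n, p.1 m n = a ∧ p.2 m (n + 1) = b
    · obtain ⟨i, j, g1, g2⟩ := hh
      exact go i j i (j + 1) (Or.inl ⟨rfl, rfl⟩) g1 g2 (hp.perf_horiz hc C1 C2 ha hb g1 g2 hv)
    · refine ⟨p, .refl, hp, hI, ?_⟩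
      intro i j k l hi hj g1 g2
      rcases hp.adj hc C1 C2 ha hb _ i j k l rfl hi hj g1 g2 with g | ⟨-, g⟩
      · exact hv g
      · exact hh g

lemma run_all {γ : ℕ → ℕ → Prop} {N A B : ℕ} (hc : Cvx γ) (hN : ∀ i j, γ i j → i < N ∧ j < N)
    (ρ : ℕ → ℕ → ℕ) (hρ1 : ∀ a a' b, a < a' → a' ≤ A → b ≤ B → ρ a' b < ρ a b)
    (hρ2 : ∀ a b b', b < b' → b' ≤ B → a ≤ A → ρ a b < ρ a b')
    (inj : ∀ a b a' b', a ≤ A → a' ≤ A → b ≤ B → b' ≤ B → ρ a b = ρ a' b' → a = a' ∧ b = b')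
    (Inv : (ℕ → ℕ → ℕ) × (ℕ → ℕ → ℕ) → Prop)
    (hInv : ∀ a b p i j k l, SG γ A B (fun a' b' => ρ a' b' < ρ a b) a b p →
      ((k = i ∧ l = j + 1) ∨ (k = i + 1 ∧ l = j)) → a ≠ 0 → b ≠ 0 →
      p.1 i j = a → p.2 k l = b → SG γ A B (fun a' b' => ρ a' b' < ρ a b) a b (sw p i j k l) →
      Inv p → Inv (sw p i j k l)) {p : (ℕ → ℕ → ℕ) × (ℕ → ℕ → ℕ)}
    (hp : SG γ A B (fun _ _ => False) 0 0 p) (hI : Inv p) :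
    ∀ n, ∃ q, Relation.ReflTransGen (SwitchStep γ) p q ∧
      SG γ A B (fun a' b' => ρ a' b' < n) 0 0 q ∧ Inv q := by
  intro n
  induction n with
  | zero => exact ⟨p, .refl, by simpa using hp, hI⟩
  | succ n ih =>
    obtain ⟨q, k1, k2, k3⟩ := ih
    by_cases hab : ∃ a b, a ≠ 0 ∧ b ≠ 0 ∧ a ≤ A ∧ b ≤ B ∧ ρ a b = n
    · obtain ⟨a, b, ha, hb, hA, hB, rfl⟩ := hab
      have hq : SG γ A B (fun a' b' => ρ a' b' < ρ a b) a b q := by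
        refine ⟨k2.pf1, k2.pf2, k2.dj, k2.fill, k2.bd1, k2.bd2, ?_, ?_⟩
        · intro i j k l hi hj g1 g2
          rcases k2.st i j k l hi hj g1 g2 with g | g
          · exact absurd g.1 g1
          · exact Or.inr g
        · intro i j k l hi hj g1 g2
          rcases k2.ts i j k l hi hj g1 g2 with g | g
          · exact absurd g.1 g2
          · exact Or.inr g
      obtain ⟨r, l1, l2, l3, l4⟩ := run_ab (a := a) (b := b)
        (Φ := fun a' b' => ρ a' b' < ρ a b) hc hN (fun a' h1 h2 => hρ1 a a' b h1 h2 hB)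
        (fun b' _ h2 => hρ2 a b' b h2 hB hA) ha hb Inv (fun p i j k l g1 g2 g3 g4 g5 g6 =>
          hInv a b p i j k l g1 g2 ha hb g3 g4 g5 g6) _ q rfl hq k3
      refine ⟨r, k1.trans l1, ⟨l2.pf1, l2.pf2, l2.dj, l2.fill, l2.bd1, l2.bd2, ?_, ?_⟩, l3⟩
      · intro i j k l hi hj g1 g2
        right
        rcases l2.st i j k l hi hj g1 g2 with g | g
        · exact absurd g.2 (l4 i j k l hi hj g.1)
        · intro hlt
          have he : ρ (r.1 i j) (r.2 k l) = ρ a b := by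
            have : ¬ ρ (r.1 i j) (r.2 k l) < ρ a b := g
            have : ρ (r.1 i j) (r.2 k l) < ρ a b + 1 := hlt
            omega
          have := inj _ _ _ _ (l2.bd1 _ _) hA (l2.bd2 _ _) hB he
          exact l4 i j k l hi hj this.1 this.2
      · intro i j k l hi hj g1 g2
        right
        show ρ _ _ < ρ a b + 1
        rcases l2.ts i j k l hi hj g1 g2 with g | g
        · rw [g.1, g.2]; omega
        · have : ρ (r.1 k l) (r.2 i j) < ρ a b := g
          omega
    · refine ⟨q, k1, ⟨k2.pf1, k2.pf2, k2.dj, k2.fill, k2.bd1, k2.bd2, ?_, ?_⟩, k3⟩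
      · intro i j k l hi hj g1 g2
        right
        rcases k2.st i j k l hi hj g1 g2 with g | g
        · exact absurd g.1 g1
        · intro hlt
          refine hab ⟨_, _, g1, g2, k2.bd1 _ _, k2.bd2 _ _, ?_⟩
          have : ¬ ρ (q.1 i j) (q.2 k l) < n := g
          have : ρ (q.1 i j) (q.2 k l) < n + 1 := hlt
          omega
      · intro i j k l hi hj g1 g2
        right
        show ρ _ _ < n + 1
        rcases k2.ts i j k l hi hj g1 g2 with g | g
        · exact absurd g.1 g2
        · have : ρ (q.1 k l) (q.2 i j) < n := g
          omega

/-- A pair in which no `S`-entry is weakly northwest of a `T`-entry. -/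
def Sorted2 (p : (ℕ → ℕ → ℕ) × (ℕ → ℕ → ℕ)) : Prop :=
  ∀ i j k l, i ≤ k → j ≤ l → p.1 i j ≠ 0 → p.2 k l = 0

lemma Sorted2.terminal {γ : ℕ → ℕ → Prop} {p : (ℕ → ℕ → ℕ) × (ℕ → ℕ → ℕ)} (h : Sorted2 p) :
    ∀ q, ¬ SwitchStep γ p q := by
  rintro q ⟨i, j, k, l, h1, h2, h3, -⟩
  exact h2 (h i j k l (by omega) (by omega) h1)

lemma run_final {γ : ℕ → ℕ → Prop} {N A B : ℕ} (hc : Cvx γ) (hN : ∀ i j, γ i j → i < N ∧ j < N)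
    (ρ : ℕ → ℕ → ℕ) (hρ1 : ∀ a a' b, a < a' → a' ≤ A → b ≤ B → ρ a' b < ρ a b)
    (hρ2 : ∀ a b b', b < b' → b' ≤ B → a ≤ A → ρ a b < ρ a b')
    (inj : ∀ a b a' b', a ≤ A → a' ≤ A → b ≤ B → b' ≤ B → ρ a b = ρ a' b' → a = a' ∧ b = b')
    (Inv : (ℕ → ℕ → ℕ) × (ℕ → ℕ → ℕ) → Prop)
    (hInv : ∀ a b p i j k l, SG γ A B (fun a' b' => ρ a' b' < ρ a b) a b p →
      ((k = i ∧ l = j + 1) ∨ (k = i + 1 ∧ l = j)) → a ≠ 0 → b ≠ 0 →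
      p.1 i j = a → p.2 k l = b → SG γ A B (fun a' b' => ρ a' b' < ρ a b) a b (sw p i j k l) →
      Inv p → Inv (sw p i j k l)) {p : (ℕ → ℕ → ℕ) × (ℕ → ℕ → ℕ)}
    (hp : SG γ A B (fun _ _ => False) 0 0 p) (hI : Inv p) :
    ∃ q, Relation.ReflTransGen (SwitchStep γ) p q ∧ PP γ q ∧
      (∀ i j, γ i j → q.1 i j ≠ 0 ∨ q.2 i j ≠ 0) ∧ Sorted2 q ∧ Inv q := by
  obtain ⟨q, k1, k2, k3⟩ := run_all hc hN ρ hρ1 hρ2 inj Inv hInv hp hI (ρ 0 B + 1)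
  refine ⟨q, k1, ⟨k2.dj, k2.pf1, k2.pf2⟩, k2.fill, ?_, k3⟩
  intro i j k l hi hj g1
  by_contra g2
  rcases k2.st i j k l hi hj g1 g2 with g | g
  · exact g1 g.1
  · apply g
    show ρ _ _ < _
    have b1 := k2.bd1 i j
    have b2 := k2.bd2 k l
    have e1 : ρ (q.1 i j) (q.2 k l) < ρ 0 (q.2 k l) := hρ1 _ _ _ (by omega) b1 b2
    rcases Nat.lt_or_eq_of_le b2 with e | e
    · have := hρ2 0 _ _ e le_rfl (by omega)
      omega
    · rw [e] at e1 ⊢; omega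

/-- The two orders on pairs of letters. -/
def rho1 (A B a b : ℕ) : ℕ := (A - a) * (B + 1) + b
/-- The second order. -/
def rho2 (A a b : ℕ) : ℕ := b * (A + 1) + (A - a)

lemma lex_aux {x y u v M : ℕ} (hu : u < M) (hv : v < M) (h : x * M + u = y * M + v) :
    x = y ∧ u = v := by
  have h1 : (x * M + u) % M = u := by rw [Nat.mul_add_mod_of_lt hu]
  have h2 : (y * M + v) % M = v := by rw [Nat.mul_add_mod_of_lt hv]
  have : u = v := by rw [← h1, ← h2, h]
  subst this
  refine ⟨?_, rfl⟩
  exact Nat.eq_of_mul_eq_mul_right (by omega) (Nat.add_right_cancel h)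

lemma lex_lt {x y u v M : ℕ} (hu : u < M) (h : x < y) : x * M + u < y * M + v := by
  have : (x + 1) * M ≤ y * M := Nat.mul_le_mul_right _ h
  rw [Nat.add_mul] at this
  omega

lemma rho1_anti {A B : ℕ} : ∀ a a' b, a < a' → a' ≤ A → b ≤ B → rho1 A B a' b < rho1 A B a b :=
  fun _ _ _ _ _ _ => lex_lt (by omega) (by omega)

lemma rho1_mono {A B : ℕ} : ∀ a b b', b < b' → b' ≤ B → a ≤ A → rho1 A B a b < rho1 A B a b' := by
  intro a b b' h _ _; unfold rho1; omega

lemma rho1_inj {A B : ℕ} : ∀ a b a' b', a ≤ A → a' ≤ A → b ≤ B → b' ≤ B →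
    rho1 A B a b = rho1 A B a' b' → a = a' ∧ b = b' := by
  intro a b a' b' _ _ _ _ h
  have := lex_aux (by omega) (by omega) h
  omega

lemma rho2_anti {A B : ℕ} : ∀ a a' b, a < a' → a' ≤ A → b ≤ B → rho2 A a' b < rho2 A a b := by
  intro a a' b _ _ _; unfold rho2; omega

lemma rho2_mono {A B : ℕ} : ∀ a b b', b < b' → b' ≤ B → a ≤ A → rho2 A a b < rho2 A a b' :=
  fun _ _ _ _ _ _ => lex_lt (by omega) (by omega)

lemma rho2_inj {A B : ℕ} : ∀ a b a' b', a ≤ A → a' ≤ A → b ≤ B → b' ≤ B →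
    rho2 A a b = rho2 A a' b' → a = a' ∧ b = b' := by
  intro a b a' b' _ _ _ _ h
  have := lex_aux (by omega) (by omega) h
  omega


/-- Knuth (plactic) equivalence of words. -/
inductive Kn : List ℕ → List ℕ → Prop
  | refl (w) : Kn w w
  | symm {u v} : Kn u v → Kn v u
  | trans {u v w} : Kn u v → Kn v w → Kn u w
  | app (u v) {w w'} : Kn w w' → Kn (u ++ w ++ v) (u ++ w' ++ v)
  | g1 {x y z} : x < y → y ≤ z → Kn [y, z, x] [y, x, z]
  | g2 {x y z} : x ≤ y → y < z → Kn [x, z, y] [z, x, y]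

lemma Kn.left (u : List ℕ) {w w' : List ℕ} (h : Kn w w') : Kn (u ++ w) (u ++ w') := by
  simpa using Kn.app u [] h

lemma Kn.right (v : List ℕ) {w w' : List ℕ} (h : Kn w w') : Kn (w ++ v) (w' ++ v) := by
  simpa using Kn.app [] v h

lemma Kn.cons (a : ℕ) {w w' : List ℕ} (h : Kn w w') : Kn (a :: w) (a :: w') := by
  simpa using Kn.left [a] h

lemma Kn.of_eq {w w' : List ℕ} (h : w = w') : Kn w w' := h ▸ Kn.refl _

lemma Kn.move : ∀ (G : List ℕ) (v u : ℕ), (v :: G).Pairwise (· ≤ ·) → u < v →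
    Kn (v :: (G ++ [u])) (v :: u :: G)
  | [], v, u, _, _ => Kn.refl _
  | g :: G, v, u, h, huv => by
    have h1 := List.pairwise_cons.1 h
    have hvg : v ≤ g := h1.1 g (by simp)
    have ih := Kn.move G g u h1.2 (by omega)
    refine (Kn.cons v ih).trans ?_
    exact Kn.right G (Kn.g1 huv hvg)

/-- Termwise domination of a prefix. -/
inductive Dom : List ℕ → List ℕ → Prop
  | nil (B) : Dom [] B
  | cons {e f E B} : f < e → Dom E B → Dom (e :: E) (f :: B)

lemma Dom.shift {E B : List ℕ} (h : Dom E B) : ∀ f, (f :: B).Pairwise (· ≤ ·) → Dom E (f :: B) := by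
  induction h with
  | nil B => intro f _; exact Dom.nil _
  | cons hlt _ ih =>
    intro f hf
    have h1 := List.pairwise_cons.1 hf
    exact Dom.cons (lt_of_le_of_lt (h1.1 _ (by simp)) hlt) (ih _ h1.2)

lemma Kn.claim1 : ∀ (E : List ℕ) (x : ℕ) (B : List ℕ), E.Pairwise (· ≤ ·) →
    (x :: B).Pairwise (· ≤ ·) → Dom E B → Kn (x :: (E ++ B)) (E ++ x :: B)
  | [], x, B, _, _, _ => Kn.refl _
  | e :: E, x, f :: B, hE, hB, hD => by
    obtain _ | ⟨hfe, hD⟩ := hD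
    have hE1 := List.pairwise_cons.1 hE
    have hB1 := List.pairwise_cons.1 hB
    have hxf : x ≤ f := hB1.1 f (by simp)
    have hB2 := List.pairwise_cons.1 hB1.2
    have hD' : Dom E (f :: B) := hD.shift f hB1.2
    have s1 : Kn (x :: (e :: E ++ f :: B)) (x :: e :: f :: (E ++ B)) := by
      have := Kn.cons x (Kn.right B (Kn.move E e f hE hfe))
      simpa using this
    have s2 : Kn (x :: e :: f :: (E ++ B)) (e :: x :: f :: (E ++ B)) :=
      Kn.right (E ++ B) (Kn.g2 hxf hfe)
    have s3 : Kn (e :: x :: f :: (E ++ B)) (e :: x :: (E ++ f :: B)) :=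
      Kn.cons e (Kn.cons x (Kn.claim1 E f B hE1.2 hB1.2 hD))
    have s4 : Kn (e :: x :: (E ++ f :: B)) (e :: (E ++ x :: f :: B)) :=
      Kn.cons e (Kn.claim1 E x (f :: B) hE1.2 hB hD')
    exact ((s1.trans s2).trans s3).trans s4

/-- The list of nonzero entries among the first `n` values of `f`. -/
def row (f : ℕ → ℕ) : ℕ → List ℕ
  | 0 => []
  | n + 1 => (if f 0 = 0 then [] else [f 0]) ++ row (fun c => f (c + 1)) n

/-- Weakly increasing nonzero values. -/
def RS (f : ℕ → ℕ) : Prop := ∀ c c', c ≤ c' → f c ≠ 0 → f c' ≠ 0 → f c ≤ f c'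

lemma RS.shift {f : ℕ → ℕ} (h : RS f) : RS (fun c => f (c + 1)) :=
  fun c c' hc => h (c + 1) (c' + 1) (by omega)

lemma mem_row : ∀ (n : ℕ) (f : ℕ → ℕ) (x : ℕ), x ∈ row f n → x ≠ 0 ∧ ∃ c, c < n ∧ f c = x
  | 0, f, x, h => by simp [row] at h
  | n + 1, f, x, h => by
    rw [row, List.mem_append] at h
    rcases h with h | h
    · split_ifs at h with h0
      · simp at h
      · simp at h; subst h; exact ⟨h0, 0, by omega, rfl⟩
    · obtain ⟨h1, c, hc, h2⟩ := mem_row n _ x h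
      exact ⟨h1, c + 1, by omega, h2⟩

lemma row_sorted : ∀ (n : ℕ) (f : ℕ → ℕ), RS f → (row f n).Pairwise (· ≤ ·)
  | 0, f, _ => by simp [row]
  | n + 1, f, h => by
    have ih := row_sorted n _ h.shift
    rw [row]
    split_ifs with h0
    · simpa using ih
    · simp only [List.singleton_append, List.pairwise_cons]
      refine ⟨?_, ih⟩
      intro y hy
      obtain ⟨h1, c, hc, h2⟩ := mem_row n _ y hy
      rw [← h2]; exact h 0 (c + 1) (by omega) h0 (by rw [← h2] at h1; exact h1)

lemma row_zero : ∀ (n : ℕ) (f : ℕ → ℕ), (∀ c, f c = 0) → row f n = []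
  | 0, f, _ => rfl
  | n + 1, f, h => by simp [row, h 0, row_zero n (fun c => f (c + 1)) (fun c => h _)]

lemma row_congr : ∀ (n : ℕ) (f f' : ℕ → ℕ), (∀ c, c < n → f c = f' c) → row f n = row f' n
  | 0, f, f', _ => rfl
  | n + 1, f, f', h => by
    rw [row, row, h 0 (by omega), row_congr n _ _ (fun c hc => h (c + 1) (by omega))]

lemma row_dom : ∀ (n : ℕ) (e b : ℕ → ℕ), (∀ c, e c ≠ 0 → b c ≠ 0 ∧ b c < e c) →
    (∀ c, e (c + 1) ≠ 0 → e c ≠ 0) → Dom (row e n) (row b n)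
  | 0, _, _, _, _ => Dom.nil _
  | n + 1, e, b, h1, h2 => by
    by_cases h0 : e 0 = 0
    · have hz : ∀ c, e c = 0 := by
        intro c
        induction c with
        | zero => exact h0
        | succ c ih => by_contra hc; exact h2 c hc ih
      rw [row_zero _ _ hz]; exact Dom.nil _
    · have hb := h1 0 h0
      rw [row, row, if_neg h0, if_neg hb.1]
      exact Dom.cons hb.2 (row_dom n _ _ (fun c => h1 (c + 1)) (fun c => h2 (c + 1)))

/-- Two-row case: an entry moves up. -/
lemma Kn.two_rows : ∀ (j n : ℕ) (f g f' g' : ℕ → ℕ), j < n → g j ≠ 0 → f j = 0 → f' j = g j →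
    g' j = 0 → (∀ c, c ≠ j → f' c = f c) → (∀ c, c ≠ j → g' c = g c) → RS g → RS f' →
    (∀ c, f c ≠ 0 → g c ≠ 0 → f c < g c) →
    (∀ c, c < j → f c ≠ 0 → g c ≠ 0) → (∀ c, j < c → g c ≠ 0 → f c ≠ 0) →
    (∀ c, j < c → g (c + 1) ≠ 0 → g c ≠ 0) →
    Kn (row g n ++ row f n) (row g' n ++ row f' n)
  | 0, n + 1, f, g, f', g', _, hg, hf, hf', hg', ef, eg, sg, sf, col, c1, c2, c3 => by
    have r1 : row g (n + 1) = g 0 :: row (fun c => g (c + 1)) n := by simp [row, hg]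
    have r2 : row f (n + 1) = row (fun c => f (c + 1)) n := by simp [row, hf]
    have r3 : row g' (n + 1) = row (fun c => g (c + 1)) n := by
      simp only [row, hg']
      simp only [if_true, List.nil_append]
      exact row_congr _ _ _ (fun c _ => eg _ (by omega))
    have r4' : row f' (n + 1) = g 0 :: row (fun c => f (c + 1)) n := by
      simp only [row, hf', if_neg hg, List.singleton_append, List.cons.injEq, true_and]
      exact row_congr _ _ _ (fun c _ => ef _ (by omega))
    have s := row_sorted (n + 1) f' sf
    rw [r4'] at s
    rw [r1, r2, r3, r4']
    refine Kn.claim1 _ _ _ (row_sorted _ _ sg.shift) s (row_dom _ _ _ ?_ ?_)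
    · intro c hc
      have := c2 (c + 1) (by omega) hc
      exact ⟨this, col _ this hc⟩
    · intro c hc; exact c3 (c + 1) (by omega) hc
  | j + 1, n + 1, f, g, f', g', hj, hg, hf, hf', hg', ef, eg, sg, sf, col, c1, c2, c3 => by
    have ih := Kn.two_rows j n (fun c => f (c + 1)) (fun c => g (c + 1)) (fun c => f' (c + 1))
      (fun c => g' (c + 1)) (by omega) hg hf hf' hg' (fun c hc => ef _ (by omega))
      (fun c hc => eg _ (by omega)) sg.shift sf.shift (fun c => col _)
      (fun c hc => c1 _ (by omega)) (fun c hc => c2 _ (by omega)) (fun c hc => c3 _ (by omega))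
    have e1 : f' 0 = f 0 := ef 0 (by omega)
    have e2 : g' 0 = g 0 := eg 0 (by omega)
    have sg' : RS g' := by
      intro c c' hc n1 n2
      have k1 : c ≠ j + 1 := by rintro rfl; exact n1 hg'
      have k2 : c' ≠ j + 1 := by rintro rfl; exact n2 hg'
      rw [eg _ k1] at n1 ⊢; rw [eg _ k2] at n2 ⊢
      exact sg _ _ hc n1 n2
    by_cases h0 : f 0 = 0
    · have r2 : row f (n + 1) = row (fun c => f (c + 1)) n := by simp [row, h0]
      have r4 : row f' (n + 1) = row (fun c => f' (c + 1)) n := by simp [row, e1, h0]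
      rw [r2, r4, row, row, e2]
      simpa using Kn.left (if g 0 = 0 then [] else [g 0]) ih
    · have hg0 := c1 0 (by omega) h0
      have hlt := col 0 h0 hg0
      have r1 : row g (n + 1) = g 0 :: row (fun c => g (c + 1)) n := by simp [row, hg0]
      have r3 : row g' (n + 1) = g 0 :: row (fun c => g' (c + 1)) n := by simp [row, e2, hg0]
      have r2 : row f (n + 1) = f 0 :: row (fun c => f (c + 1)) n := by simp [row, h0]
      have r4 : row f' (n + 1) = f 0 :: row (fun c => f' (c + 1)) n := by simp [row, e1, h0]
      have s1 := row_sorted (n + 1) g sg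
      have s2 := row_sorted (n + 1) g' sg'
      rw [r1] at s1
      rw [r3] at s2
      have m1 := Kn.right (row (fun c => f (c + 1)) n) (Kn.move _ _ _ s1 hlt)
      have m2 := Kn.right (row (fun c => f' (c + 1)) n) (Kn.move _ _ _ s2 hlt)
      have m3 := Kn.cons (g 0) (Kn.cons (f 0) ih)
      rw [r1, r2, r3, r4]
      refine Kn.trans ?_ (Kn.trans m3 ?_)
      · simpa using m1
      · simpa using m2.symm

lemma row_horiz : ∀ (j n : ℕ) (f f' : ℕ → ℕ), j + 1 < n → f j = 0 → f' j = f (j + 1) →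
    f' (j + 1) = 0 → (∀ c, c ≠ j → c ≠ j + 1 → f' c = f c) → row f' n = row f n
  | 0, n + 2, f, f', _, h1, h2, h3, h4 => by
    simp only [row, h1, h2, h3, Nat.zero_add]
    simp only [if_true, List.nil_append]
    congr 1
    exact row_congr _ _ _ (fun c _ => h4 _ (by omega) (by omega))
  | j + 1, n + 1, f, f', h0, h1, h2, h3, h4 => by
    rw [row, row, h4 0 (by omega) (by omega),
      row_horiz j n (fun c => f (c + 1)) (fun c => f' (c + 1)) (by omega) h1 h2 h3
        (fun c _ _ => h4 _ (by omega) (by omega))]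

/-- The reading word of a filling: rows from bottom to top. -/
def wd (n : ℕ) : ℕ → (ℕ → ℕ → ℕ) → List ℕ
  | 0, _ => []
  | L + 1, T => wd n L (fun i => T (i + 1)) ++ row (T 0) n

lemma wd_congr (n : ℕ) : ∀ (L : ℕ) (T T' : ℕ → ℕ → ℕ),
    (∀ i, i < L → row (T i) n = row (T' i) n) → wd n L T = wd n L T'
  | 0, _, _, _ => rfl
  | L + 1, T, T', h => by
    rw [wd, wd, h 0 (by omega), wd_congr n L _ _ (fun i hi => h (i + 1) (by omega))]

lemma wd_two (n : ℕ) : ∀ (i L : ℕ) (T T' : ℕ → ℕ → ℕ), i + 1 < L →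
    (∀ k, k ≠ i → k ≠ i + 1 → row (T k) n = row (T' k) n) →
    Kn (row (T (i + 1)) n ++ row (T i) n) (row (T' (i + 1)) n ++ row (T' i) n) →
    Kn (wd n L T) (wd n L T')
  | 0, L + 2, T, T', _, h, hk => by
    simp only [wd]
    rw [wd_congr n L _ (fun i => T' (i + 1 + 1)) (fun i _ => h (i + 1 + 1) (by omega) (by omega))]
    simpa using Kn.left _ hk
  | i + 1, L + 1, T, T', hL, h, hk => by
    rw [wd, wd, h 0 (by omega) (by omega)]
    exact Kn.right _ (wd_two n i L _ _ (by omega) (fun k _ _ => h (k + 1) (by omega) (by omega)) hk)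

/-- Moving an entry up preserves the plactic class of the reading word. -/
lemma wd_vert {γ : ℕ → ℕ → Prop} {F : ℕ → ℕ → ℕ} {i j n L : ℕ} (hF : IsPerforated γ F)
    (hF' : IsPerforated γ (mv F (i + 1) j i j)) (hL : i + 1 < L) (hn : j < n)
    (h1 : F (i + 1) j ≠ 0) (h2 : F i j = 0)
    (c1 : ∀ c, c < j → F i c ≠ 0 → F (i + 1) c ≠ 0) (c2 : ∀ c, j < c → F (i + 1) c ≠ 0 → F i c ≠ 0)
    (c3 : ∀ c, j < c → F (i + 1) (c + 1) ≠ 0 → F (i + 1) c ≠ 0) :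
    Kn (wd n L F) (wd n L (mv F (i + 1) j i j)) := by
  refine wd_two n i L _ _ hL ?_ ?_
  · intro k k1 k2
    congr 1
    funext c
    rw [mv_apply, if_neg (by omega), if_neg (by omega)]
  · refine Kn.two_rows j n _ _ _ _ hn h1 h2 ?_ ?_ ?_ ?_ ?_ ?_ ?_ c1 c2 c3
    · rw [mv_apply]; simp
    · rw [mv_apply]; simp
    · intro c hc; rw [mv_apply, if_neg (by omega), if_neg (by omega)]
    · intro c hc; rw [mv_apply, if_neg (by omega), if_neg (by omega)]
    · intro c c' hc n1 n2; exact hF.2.2 _ _ _ _ le_rfl hc n1 n2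
    · intro c c' hc n1 n2; exact hF'.2.2 _ _ _ _ le_rfl hc n1 n2
    · intro c n1 n2; exact hF.2.1 _ _ _ (by omega) n1 n2

lemma wd_horiz {F : ℕ → ℕ → ℕ} {i j n L : ℕ} (hn : j + 1 < n) (h2 : F i j = 0) :
    wd n L (mv F i (j + 1) i j) = wd n L F := by
  refine wd_congr n L _ _ ?_
  intro k _
  by_cases hk : k = i
  · subst hk
    refine row_horiz j n _ _ hn h2 ?_ ?_ ?_
    · rw [mv_apply]; simp
    · rw [mv_apply]; simp
    · intro c _ _; rw [mv_apply, if_neg (by omega), if_neg (by omega)]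
  · congr 1
    funext c
    rw [mv_apply, if_neg (by omega), if_neg (by omega)]


lemma Kn.perm {u v : List ℕ} (h : Kn u v) : u.Perm v := by
  induction h with
  | refl w => exact List.Perm.refl _
  | symm _ ih => exact ih.symm
  | trans _ _ ih1 ih2 => exact ih1.trans ih2
  | app u v _ ih => exact (ih.append_left u).append_right v
  | @g1 x y z _ _ => exact (List.Perm.swap x z []).cons y
  | @g2 x y z _ _ => exact List.Perm.swap z x [y]

lemma Kn.filt (N : ℕ) {u v : List ℕ} (h : Kn u v) :
    Kn (u.filter (fun k => decide (k < N))) (v.filter (fun k => decide (k < N))) := by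
  induction h with
  | refl w => exact Kn.refl _
  | symm _ ih => exact ih.symm
  | trans _ _ ih1 ih2 => exact ih1.trans ih2
  | app u v _ ih =>
    simp only [List.filter_append]
    exact Kn.app _ _ ih
  | @g1 x y z h1 h2 =>
    by_cases hz : z < N
    · have hy : y < N := by omega
      have hx : x < N := by omega
      simp only [List.filter, hx, hy, hz, decide_true]
      exact Kn.g1 h1 h2
    · by_cases hy : y < N
      · have hx : x < N := by omega
        simp only [List.filter, hx, hy, hz, decide_true, decide_false]
        exact Kn.refl _
      · by_cases hx : x < N
        · simp only [List.filter, hx, hy, hz, decide_true, decide_false]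
          exact Kn.refl _
        · simp only [List.filter, hx, hy, hz, decide_false]
          exact Kn.refl _
  | @g2 x y z h1 h2 =>
    by_cases hz : z < N
    · have hy : y < N := by omega
      have hx : x < N := by omega
      simp only [List.filter, hx, hy, hz, decide_true]
      exact Kn.g2 h1 h2
    · by_cases hy : y < N
      · have hx : x < N := by omega
        simp only [List.filter, hx, hy, hz, decide_true, decide_false]
        exact Kn.refl _
      · by_cases hx : x < N
        · simp only [List.filter, hx, hy, hz, decide_true, decide_false]
          exact Kn.refl _
        · simp only [List.filter, hx, hy, hz, decide_false]
          exact Kn.refl _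

/-- The letter bumped by `x` from the row with multiplicities `m` (`≥ N` if there is none). -/
noncomputable def nx (N : ℕ) (m : ℕ → ℕ) (x : ℕ) : ℕ :=
  sInf {y | x < y ∧ (m y ≠ 0 ∨ N ≤ y)}

lemma nx_spec (N : ℕ) (m : ℕ → ℕ) (x : ℕ) :
    x < nx N m x ∧ (m (nx N m x) ≠ 0 ∨ N ≤ nx N m x) ∧
      ∀ y, x < y → y < nx N m x → m y = 0 ∧ y < N := by
  have hne : {y | x < y ∧ (m y ≠ 0 ∨ N ≤ y)}.Nonempty :=
    ⟨x + N + 1, by constructor <;> omega⟩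
  have h := Nat.sInf_mem hne
  refine ⟨h.1, h.2, ?_⟩
  intro y h1 h2
  have := Nat.notMem_of_lt_sInf h2
  simp only [Set.mem_ofPred_eq] at this
  omega

lemma nx_eq {N : ℕ} {m : ℕ → ℕ} {x y : ℕ} (h1 : x < y) (h2 : m y ≠ 0 ∨ N ≤ y)
    (h3 : ∀ k, x < k → k < y → m k = 0 ∧ k < N) : nx N m x = y := by
  obtain ⟨g1, g2, g3⟩ := nx_spec N m x
  rcases lt_trichotomy (nx N m x) y with h | h | h
  · have := h3 _ g1 h; omega
  · exact h
  · have := g3 _ h1 h; omega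

/-- Row insertion on multiplicities. -/
noncomputable def ins (N : ℕ) (m : ℕ → ℕ) (x : ℕ) : ℕ → ℕ := fun k =>
  m k + (if k = x then 1 else 0) - (if k = nx N m x then 1 else 0)

/-- Final row after inserting a word. -/
noncomputable def fin (N : ℕ) : (ℕ → ℕ) → List ℕ → (ℕ → ℕ)
  | m, [] => m
  | m, x :: w => fin N (ins N m x) w

/-- Bumped letters when inserting a word. -/
noncomputable def out (N : ℕ) : (ℕ → ℕ) → List ℕ → List ℕ
  | _, [] => []
  | m, x :: w => nx N m x :: out N (ins N m x) w

lemma fin_append (N : ℕ) : ∀ (u v : List ℕ) (m : ℕ → ℕ), fin N m (u ++ v) = fin N (fin N m u) v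
  | [], _, _ => rfl
  | x :: u, v, m => by simp only [List.cons_append, fin]; exact fin_append N u v _

lemma out_append (N : ℕ) : ∀ (u v : List ℕ) (m : ℕ → ℕ),
    out N m (u ++ v) = out N m u ++ out N (fin N m u) v
  | [], _, _ => rfl
  | x :: u, v, m => by simp only [List.cons_append, out, fin]; rw [out_append N u v _]

lemma nx_le {N x : ℕ} {m : ℕ → ℕ} (hx : x < N) : nx N m x ≤ N := by
  obtain ⟨g1, g2, g3⟩ := nx_spec N m x
  by_contra h
  have := g3 N hx (by omega)
  omega

lemma ins_zero {N x : ℕ} {m : ℕ → ℕ} (hm : ∀ k, N ≤ k → m k = 0) (hx : x < N) :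
    ∀ k, N ≤ k → ins N m x k = 0 := by
  intro k hk
  simp only [ins, hm k hk]
  split_ifs <;> omega

lemma fin_zero {N : ℕ} : ∀ (w : List ℕ) (m : ℕ → ℕ), (∀ x ∈ w, x < N) → (∀ k, N ≤ k → m k = 0) →
    ∀ k, N ≤ k → fin N m w k = 0
  | [], m, _, hm => hm
  | x :: w, m, hw, hm => fin_zero w _ (fun y hy => hw y (by simp [hy]))
      (ins_zero hm (hw x (by simp)))

lemma ins_g1 {N x y z : ℕ} {m : ℕ → ℕ} (h1 : x < y) (h2 : y ≤ z) (hz : z < N)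
    (hm : ∀ k, N ≤ k → m k = 0) :
    fin N m [y, z, x] = fin N m [y, x, z] ∧ Kn (out N m [y, z, x]) (out N m [y, x, z]) := by
  obtain ⟨y', hy'⟩ : ∃ y', nx N m y = y' := ⟨_, rfl⟩
  obtain ⟨a1, a2, a3⟩ := nx_spec N m y
  have a4 := nx_le (m := m) (show y < N by omega)
  rw [hy'] at a1 a2 a3 a4
  obtain ⟨m1, hm1⟩ : ∃ m1, ins N m y = m1 := ⟨_, rfl⟩
  have e1 : ∀ k, m1 k = m k + (if k = y then 1 else 0) - (if k = y' then 1 else 0) := by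
    intro k; rw [← hm1, ins, hy']
  obtain ⟨z', hz'⟩ : ∃ z', nx N m1 z = z' := ⟨_, rfl⟩
  obtain ⟨b1, b2, b3⟩ := nx_spec N m1 z
  have b4 := nx_le (m := m1) hz
  rw [hz'] at b1 b2 b3 b4
  obtain ⟨x', hx'⟩ : ∃ x', nx N m1 x = x' := ⟨_, rfl⟩
  obtain ⟨c1, c2, c3⟩ := nx_spec N m1 x
  rw [hx'] at c1 c2 c3
  have y1 : m1 y ≠ 0 := by rw [e1]; split_ifs <;> omega
  have hxy : x' ≤ y := by
    by_contra h
    have := c3 y h1 (by omega)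
    omega
  have hyz : y' ≤ z' := by
    by_contra h
    have := a3 z' (by omega) (by omega)
    have e := e1 z'
    rw [if_neg (by omega), if_neg (by omega)] at e
    omega
  -- the two orders of the last insertions
  obtain ⟨m2, hm2⟩ : ∃ m2, ins N m1 z = m2 := ⟨_, rfl⟩
  have e2 : ∀ k, m2 k = m1 k + (if k = z then 1 else 0) - (if k = z' then 1 else 0) := by
    intro k; rw [← hm2, ins, hz']
  obtain ⟨m3, hm3⟩ : ∃ m3, ins N m1 x = m3 := ⟨_, rfl⟩
  have e3 : ∀ k, m3 k = m1 k + (if k = x then 1 else 0) - (if k = x' then 1 else 0) := by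
    intro k; rw [← hm3, ins, hx']
  have n2 : nx N m2 x = x' := by
    refine nx_eq c1 ?_ ?_
    · rw [e2, if_neg (show ¬ x' = z' by omega)]; omega
    · intro k k1 k2
      have := c3 k k1 k2
      rw [e2, if_neg (show ¬ k = z by omega), if_neg (show ¬ k = z' by omega)]; omega
  have n3 : nx N m3 z = z' := by
    refine nx_eq b1 ?_ ?_
    · rw [e3, if_neg (show ¬ z' = x' by omega)]; omega
    · intro k k1 k2
      have := b3 k k1 k2
      rw [e3, if_neg (show ¬ k = x by omega), if_neg (show ¬ k = x' by omega)]; omega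
  constructor
  · simp only [fin, hm1, hm2, hm3]
    funext k
    simp only [ins, n2, n3, e2, e3]
    have : m1 N = 0 := by rw [← hm1]; exact ins_zero hm (by omega) N le_rfl
    by_cases k1 : k = x'
    · have c2' : m1 k ≠ 0 := by
        subst k1
        have : k < N := by omega
        omega
      have f1 : ¬ k = z' := by omega
      simp only [if_pos k1, if_neg f1]
      omega
    · simp only [if_neg k1]
      by_cases k2 : k = z'
      · have f1 : ¬ k = x := by omega
        have f2 : ¬ k = z := by omega
        simp only [if_pos k2, if_neg f1, if_neg f2]
        omega
      · simp only [if_neg k2]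
        omega
  · simp only [out, hm1, hm2, hm3, hy', hz', hx', n2, n3]
    exact Kn.g1 (by omega) hyz

lemma ins_g2 {N x y z : ℕ} {m : ℕ → ℕ} (h1 : x ≤ y) (h2 : y < z) (hz : z < N)
    (hm : ∀ k, N ≤ k → m k = 0) :
    fin N m [x, z, y] = fin N m [z, x, y] ∧ Kn (out N m [x, z, y]) (out N m [z, x, y]) := by
  have mN := hm N le_rfl
  obtain ⟨x', hx'⟩ : ∃ x', nx N m x = x' := ⟨_, rfl⟩
  obtain ⟨a1, a2, a3⟩ := nx_spec N m x
  have a4 := nx_le (m := m) (show x < N by omega)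
  rw [hx'] at a1 a2 a3 a4
  obtain ⟨m1, hm1⟩ : ∃ m1, ins N m x = m1 := ⟨_, rfl⟩
  have e1 : ∀ k, m1 k = m k + (if k = x then 1 else 0) - (if k = x' then 1 else 0) := by
    intro k; rw [← hm1, ins, hx']
  obtain ⟨w, hw⟩ : ∃ w, nx N m1 z = w := ⟨_, rfl⟩
  obtain ⟨b1, b2, b3⟩ := nx_spec N m1 z
  have b4 := nx_le (m := m1) hz
  rw [hw] at b1 b2 b3 b4
  have m1N : m1 N = 0 := by rw [← hm1]; exact ins_zero hm (by omega) N le_rfl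
  obtain ⟨m2, hm2⟩ : ∃ m2, ins N m1 z = m2 := ⟨_, rfl⟩
  have e2 : ∀ k, m2 k = m1 k + (if k = z then 1 else 0) - (if k = w then 1 else 0) := by
    intro k; rw [← hm2, ins, hw]
  by_cases hc : x' ≤ z
  · have q1 : nx N m z = w := by
      refine nx_eq b1 ?_ ?_
      · have := e1 w
        rw [if_neg (show ¬ w = x by omega), if_neg (show ¬ w = x' by omega)] at this
        omega
      · intro k k1 k2
        have := b3 k k1 k2
        have := e1 k
        rw [if_neg (show ¬ k = x by omega), if_neg (show ¬ k = x' by omega)] at this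
        omega
    obtain ⟨m3, hm3⟩ : ∃ m3, ins N m z = m3 := ⟨_, rfl⟩
    have e3 : ∀ k, m3 k = m k + (if k = z then 1 else 0) - (if k = w then 1 else 0) := by
      intro k; rw [← hm3, ins, q1]
    have q2 : nx N m3 x = x' := by
      refine nx_eq a1 ?_ ?_
      · rw [e3, if_neg (show ¬ x' = w by omega)]; omega
      · intro k k1 k2
        have := a3 k k1 k2
        rw [e3, if_neg (show ¬ k = z by omega), if_neg (show ¬ k = w by omega)]; omega
    have q3 : ins N m3 x = m2 := by
      funext k
      rw [ins, q2, e3, e2, e1]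
      by_cases k1 : k = x'
      · subst k1
        rw [if_neg (show ¬ k = w by omega), if_neg (show ¬ k = x by omega)]
        have : m k ≠ 0 := by omega
        simp only [if_true]
        omega
      · simp only [if_neg k1]
        by_cases k2 : k = w
        · have f1 : ¬ k = x := by omega
          have f2 : ¬ k = z := by omega
          simp only [if_pos k2, if_neg f1, if_neg f2]
          omega
        · simp only [if_neg k2]
          omega
    constructor
    · simp only [fin, hm1, hm2, hm3, q3]
    · simp only [out, hm1, hm2, hm3, q3, q1, q2, hx', hw]
      obtain ⟨d1, d2, d3⟩ := nx_spec N m2 y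
      set y' := nx N m2 y with hy'
      have y1 : y' ≤ z := by
        by_contra h
        have := d3 z h2 (by omega)
        have e := e2 z
        rw [if_pos rfl, if_neg (show ¬ z = w by omega)] at e
        omega
      refine Kn.g2 ?_ (by omega)
      by_contra h
      have := a3 y' (by omega) (by omega)
      have f := e1 y'
      rw [if_neg (show ¬ y' = x by omega), if_neg (show ¬ y' = x' by omega)] at f
      have g := e2 y'
      rw [if_neg (show ¬ y' = z by omega), if_neg (show ¬ y' = w by omega)] at g
      omega
  · have hxw : x' ≤ w := by
      by_contra h
      have := a3 w (by omega) (by omega)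
      have f := e1 w
      rw [if_neg (show ¬ w = x by omega), if_neg (show ¬ w = x' by omega)] at f
      omega
    have q1 : nx N m z = x' := by
      refine nx_eq (by omega) a2 ?_
      intro k k1 k2
      exact a3 k (by omega) k2
    obtain ⟨m3, hm3⟩ : ∃ m3, ins N m z = m3 := ⟨_, rfl⟩
    have e3 : ∀ k, m3 k = m k + (if k = z then 1 else 0) - (if k = x' then 1 else 0) := by
      intro k; rw [← hm3, ins, q1]
    have q2 : nx N m3 x = z := by
      refine nx_eq (by omega) ?_ ?_
      · rw [e3, if_pos rfl, if_neg (show ¬ z = x' by omega)]; omega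
      · intro k k1 k2
        have := a3 k k1 (by omega)
        rw [e3, if_neg (show ¬ k = z by omega), if_neg (show ¬ k = x' by omega)]; omega
    have q3 : ins N m3 x = m1 := by
      funext k
      rw [ins, q2, e3, e1]
      by_cases k1 : k = x'
      · subst k1
        rw [if_neg (show ¬ k = z by omega), if_neg (show ¬ k = x by omega)]
        omega
      · simp only [if_neg k1]
        omega
    have q4 : nx N m2 y = z := by
      refine nx_eq h2 ?_ ?_
      · rw [e2, if_pos rfl, if_neg (show ¬ z = w by omega)]; omega
      · intro k k1 k2
        have := a3 k (by omega) (by omega)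
        rw [e2, if_neg (show ¬ k = z by omega), if_neg (show ¬ k = w by omega), e1,
          if_neg (show ¬ k = x by omega), if_neg (show ¬ k = x' by omega)]; omega
    have q5 : nx N m1 y = w := by
      refine nx_eq (by omega) b2 ?_
      intro k k1 k2
      by_cases hk : z < k
      · exact b3 k hk k2
      · have := a3 k (by omega) (by omega)
        rw [e1, if_neg (show ¬ k = x by omega), if_neg (show ¬ k = x' by omega)]; omega
    constructor
    · simp only [fin, hm1, hm2, hm3, q3]
      funext k
      rw [ins, ins, q4, q5, e2]
      by_cases k2 : k = w
      · have f1 : ¬ k = y := by omega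
        have f2 : ¬ k = z := by omega
        simp only [if_pos k2, if_neg f1, if_neg f2]
        omega
      · simp only [if_neg k2]
        omega
    · simp only [out, hm1, hm2, hm3, q3, q1, q2, q4, q5, hx', hw]
      exact Kn.g1 (by omega) hxw

lemma Kn.ins_inv {N : ℕ} {u v : List ℕ} (h : Kn u v) : (∀ x ∈ u, x < N) →
    ∀ m : ℕ → ℕ, (∀ k, N ≤ k → m k = 0) → fin N m u = fin N m v ∧ Kn (out N m u) (out N m v) := by
  induction h with
  | refl w => intro _ m _; exact ⟨rfl, Kn.refl _⟩
  | symm h ih =>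
    intro hu m hm
    have := ih (fun x hx => hu x (h.perm.mem_iff.1 hx)) m hm
    exact ⟨this.1.symm, this.2.symm⟩
  | trans h1 _ ih1 ih2 =>
    intro hu m hm
    have g1 := ih1 hu m hm
    have g2 := ih2 (fun x hx => hu x (h1.perm.mem_iff.2 hx)) m hm
    exact ⟨g1.1.trans g2.1, g1.2.trans g2.2⟩
  | app u v _ ih =>
    intro hu m hm
    have g := ih (fun x hx => hu x (by simp [hx])) (fin N m u)
      (fin_zero _ _ (fun x hx => hu x (by simp [hx])) hm)
    simp only [fin_append, out_append]
    rw [g.1]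
    exact ⟨rfl, Kn.app _ _ g.2⟩
  | g1 h1 h2 => intro hu m hm; exact ins_g1 h1 h2 (hu _ (by simp)) hm
  | g2 h1 h2 => intro hu m hm; exact ins_g2 h1 h2 (hu _ (by simp)) hm

/-- Multiplicities of a list. -/
def cnt (l : List ℕ) : ℕ → ℕ := fun k => l.count k

lemma two_row_ins {N : ℕ} : ∀ (A P B : List ℕ), (∀ p ∈ P, ∀ a ∈ A, p ≤ a) →
    A.Pairwise (· ≤ ·) → B.Pairwise (· ≤ ·) → Dom B A → (∀ a ∈ A, a < N) → (∀ b ∈ B, b < N) →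
    fin N (cnt (P ++ B)) A = cnt (P ++ A) ∧
      (out N (cnt (P ++ B)) A).filter (fun k => decide (k < N)) = B
  | [], P, B, _, _, _, hD, _, _ => by
    cases hD
    simp [fin, out]
  | a :: A, P, B, hP, hA, hB, hD, hAN, hBN => by
    have hA1 := List.pairwise_cons.1 hA
    have hP' : ∀ p ∈ P ++ [a], ∀ x ∈ A, p ≤ x := by
      intro p hp x hx
      rw [List.mem_append] at hp
      rcases hp with hp | hp
      · exact hP p hp x (by simp [hx])
      · simp at hp; subst hp; exact hA1.1 x hx
    have aN : a < N := hAN a (by simp)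
    have Pz : ∀ k, a < k → List.count k P = 0 := by
      intro k hk
      rw [List.count_eq_zero]
      intro hmem
      have := hP k hmem a (by simp)
      omega
    rcases hD with _ | ⟨hlt, hD⟩
    · have ih := two_row_ins A (P ++ [a]) [] hP' hA1.2 hB (Dom.nil _)
        (fun x hx => hAN x (by simp [hx])) hBN
      have q : nx N (cnt (P ++ [])) a = N := by
        refine nx_eq aN (Or.inr le_rfl) ?_
        intro k k1 k2
        refine ⟨?_, k2⟩
        simp [cnt, Pz k k1]
      have r : ins N (cnt (P ++ [])) a = cnt (P ++ [a] ++ []) := by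
        funext k
        rw [ins, q]
        simp only [cnt, List.append_nil, List.count_append, List.count_singleton, beq_iff_eq]
        have := Pz N aN
        by_cases hk : k = N
        · have z1 : List.count k P = 0 := Pz k (by omega)
          rw [if_pos hk, if_neg (show ¬ k = a by omega), if_neg (show ¬ a = k by omega)]; omega
        · rw [if_neg hk]; simp [eq_comm]
      simp only [fin, out, q, r]
      refine ⟨by rw [ih.1]; simp, ?_⟩
      rw [List.filter_cons_of_neg (by simp)]
      exact ih.2
    · rename_i b B
      have hB1 := List.pairwise_cons.1 hB
      have ih := two_row_ins A (P ++ [a]) B hP' hA1.2 hB1.2 hD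
        (fun x hx => hAN x (by simp [hx])) (fun x hx => hBN x (by simp [hx]))
      have bN : b < N := hBN b (by simp)
      have q : nx N (cnt (P ++ b :: B)) a = b := by
        refine nx_eq hlt (Or.inl ?_) ?_
        · simp [cnt]
        intro k k1 k2
        refine ⟨?_, by omega⟩
        have : List.count k (b :: B) = 0 := by
          rw [List.count_eq_zero]
          intro hmem
          rw [List.mem_cons] at hmem
          rcases hmem with h | h
          · omega
          · have := hB1.1 k h; omega
        simp only [cnt, List.count_append, Pz k k1, this]
      have r : ins N (cnt (P ++ b :: B)) a = cnt (P ++ [a] ++ B) := by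
        funext k
        rw [ins, q]
        simp only [cnt, List.count_append, List.count_cons, List.count_nil, beq_iff_eq]
        simp only [eq_comm (a := k)]
        omega
      simp only [fin, out, q, r]
      refine ⟨by rw [ih.1]; simp, ?_⟩
      rw [List.filter_cons_of_pos (by simp [bN]), ih.2]

/-- Fillings whose rows are sorted and dominate each other, as in a straight tableau. -/
def Strt (n : ℕ) (U : ℕ → ℕ → ℕ) : Prop :=
  (∀ i, RS (U i)) ∧ ∀ i, Dom (row (U (i + 1)) n) (row (U i) n)

lemma Strt.shift {n : ℕ} {U : ℕ → ℕ → ℕ} (h : Strt n U) : Strt n (fun i => U (i + 1)) :=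
  ⟨fun i => h.1 (i + 1), fun i => h.2 (i + 1)⟩

lemma mem_wd (n : ℕ) : ∀ (L : ℕ) (U : ℕ → ℕ → ℕ) (x : ℕ), x ∈ wd n L U →
    ∃ i c, i < L ∧ c < n ∧ U i c = x
  | 0, U, x, h => by simp [wd] at h
  | L + 1, U, x, h => by
    rw [wd, List.mem_append] at h
    rcases h with h | h
    · obtain ⟨i, c, h1, h2, h3⟩ := mem_wd n L _ x h
      exact ⟨i + 1, c, by omega, h2, h3⟩
    · obtain ⟨-, c, h2, h3⟩ := mem_row n _ x h
      exact ⟨0, c, by omega, h2, h3⟩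

lemma strt_ins {N n : ℕ} : ∀ (L : ℕ) (U : ℕ → ℕ → ℕ), Strt n U → (∀ i j, U i j < N) →
    (∀ i, L + 1 ≤ i → ∀ c, U i c = 0) →
    fin N (cnt []) (wd n (L + 1) U) = cnt (row (U 0) n) ∧
    (out N (cnt []) (wd n (L + 1) U)).filter (fun k => decide (k < N)) =
      wd n L (fun i => U (i + 1))
  | 0, U, h, hN, hz => by
    have hr : row (U 1) n = [] := row_zero _ _ (hz 1 (by omega))
    have hD := h.2 0
    rw [hr] at hD
    have := two_row_ins (N := N) (row (U 0) n) [] [] (by simp) (row_sorted _ _ (h.1 0)) (by simp) hD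
      (fun a ha => by obtain ⟨-, c, -, rfl⟩ := mem_row _ _ _ ha; exact hN _ _) (by simp)
    simpa [wd] using this
  | L + 1, U, h, hN, hz => by
    have ih := strt_ins L (fun i => U (i + 1)) h.shift (fun i j => hN _ _)
      (fun i hi => hz (i + 1) (by omega))
    have hb : ∀ i, ∀ a ∈ row (U i) n, a < N := by
      intro i a ha; obtain ⟨-, c, -, rfl⟩ := mem_row _ _ _ ha; exact hN _ _
    have := two_row_ins (N := N) (row (U 0) n) [] (row (U 1) n) (by simp) (row_sorted _ _ (h.1 0))
      (row_sorted _ _ (h.1 1)) (h.2 0) (hb 0) (hb 1)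
    simp only [List.nil_append] at this
    rw [wd, fin_append, out_append, List.filter_append, ih.1, ih.2]
    simp only [Nat.zero_add]
    rw [this.1, this.2]
    exact ⟨rfl, rfl⟩

lemma strt_unique {N n : ℕ} : ∀ (L : ℕ) (U U' : ℕ → ℕ → ℕ), Strt n U → Strt n U' →
    (∀ i j, U i j < N) → (∀ i j, U' i j < N) →
    (∀ i, L ≤ i → ∀ c, U i c = 0) → (∀ i, L ≤ i → ∀ c, U' i c = 0) →
    Kn (wd n L U) (wd n L U') → ∀ i, row (U i) n = row (U' i) n
  | 0, U, U', _, _, _, _, hz, hz', _ => by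
    intro i; rw [row_zero _ _ (hz i (by omega)), row_zero _ _ (hz' i (by omega))]
  | L + 1, U, U', h, h', hN, hN', hz, hz', hk => by
    have s := strt_ins L U h hN hz
    have s' := strt_ins L U' h' hN' hz'
    have hk' := hk.ins_inv (N := N) (fun x hx => by
      obtain ⟨i, c, -, -, rfl⟩ := mem_wd _ _ _ _ hx; exact hN _ _) (cnt []) (by simp [cnt])
    have hf := hk'.2.filt N
    rw [s.2, s'.2] at hf
    have hr := hk'.1
    rw [s.1, s'.1] at hr
    have h0 : row (U 0) n = row (U' 0) n := by
      refine List.Perm.eq_of_pairwise (le := (· ≤ ·)) (fun a b _ _ h1 h2 => le_antisymm h1 h2)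
        (row_sorted _ _ (h.1 0)) (row_sorted _ _ (h'.1 0)) ?_
      rw [List.perm_iff_count]
      intro k; exact congrFun hr k
    have ih := strt_unique L (fun i => U (i + 1)) (fun i => U' (i + 1)) h.shift h'.shift
      (fun i j => hN _ _) (fun i j => hN' _ _) (fun i hi => hz (i + 1) (by omega))
      (fun i hi => hz' (i + 1) (by omega)) hf
    intro i
    cases i with
    | zero => exact h0
    | succ i => exact ih i

lemma row_prefix : ∀ (n m : ℕ) (f : ℕ → ℕ), m ≤ n → (∀ c, f c ≠ 0 ↔ c < m) →
    ∀ c, f c = (row f n).getD c 0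
  | 0, m, f, hm, h, c => by
    have := h c; simp [row]; omega
  | n + 1, 0, f, hm, h, c => by
    have hz : ∀ c, f c = 0 := fun c => by have := h c; omega
    rw [row_zero _ _ hz, hz]; simp
  | n + 1, m + 1, f, hm, h, c => by
    have h0 : f 0 ≠ 0 := (h 0).2 (by omega)
    rw [row, if_neg h0]
    cases c with
    | zero => simp
    | succ c =>
      have := row_prefix n m (fun c => f (c + 1)) (by omega) (fun c => by
        have := h (c + 1); show f (c + 1) ≠ 0 ↔ c < m; omega) c
      simpa using this


lemma anti_le {p : ℕ → ℕ} (h : ∀ i, p (i + 1) ≤ p i) {i j : ℕ} (hij : i ≤ j) : p j ≤ p i :=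
  antitone_nat_of_succ_le h hij

lemma mv_eq_upd (T : ℕ → ℕ → ℕ) {i j k l : ℕ} (h : ¬ (i = k ∧ j = l)) :
    upd2 (upd2 T i j (T k l)) k l 0 = mv T k l i j := by
  funext a b
  simp only [upd2, mv_apply]
  by_cases h1 : a = k ∧ b = l
  · rw [if_pos h1, if_neg (by omega), if_pos h1]
  · rw [if_neg h1, if_neg h1]

/-- A state in the course of a slide, with the hole at `(i,j)`. -/
structure SL (be al : ℕ → ℕ) (T : ℕ → ℕ → ℕ) (i j : ℕ) : Prop where
  hb : ∀ i, be (i + 1) ≤ be i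
  ha : ∀ i, al (i + 1) ≤ al i
  h1 : al i ≤ j
  h2 : j < be i
  sup : ∀ a b, T a b ≠ 0 ↔ (al a ≤ b ∧ b < be a ∧ ¬ (a = i ∧ b = j))
  pf : IsPerforated (SkewYCell be al) T

lemma SL.zero {be al T i j} (h : SL be al T i j) : T i j = 0 := by
  have := h.sup i j; omega

lemma SL.right {be al T i j} (h : SL be al T i j) (hr : T i (j + 1) ≠ 0)
    (hd : T (i + 1) j = 0 ∨ T i (j + 1) < T (i + 1) j) :
    SL be al (mv T i (j + 1) i j) i (j + 1) := by
  have sr := (h.sup _ _).1 hr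
  have hz := h.zero
  refine ⟨h.hb, h.ha, sr.1, sr.2.1, ?_, ?_⟩
  · intro a b
    rw [mv_apply]
    split_ifs with g1 g2
    · obtain ⟨rfl, rfl⟩ := g1
      have := h.h1
      have := h.h2
      simp [hr]; omega
    · simp; omega
    · rw [h.sup]; omega
  · have key1 : ∀ k, k < i → T k j ≠ 0 → T k j < T i (j + 1) := by
      intro k hk hT
      have s1 := (h.sup _ _).1 hT
      have s2 : be i ≤ be k := anti_le h.hb (by omega)
      have s3 : T k (j + 1) ≠ 0 := (h.sup _ _).2 (by omega)
      exact lt_of_le_of_lt (h.pf.2.2 _ _ _ _ le_rfl (by omega) hT s3) (h.pf.2.1 _ _ _ hk s3 hr)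
    have key2 : ∀ k, i < k → T k j ≠ 0 → T i (j + 1) < T k j := by
      intro k hk hT
      have s1 := (h.sup _ _).1 hT
      have s2 : be k ≤ be (i + 1) := anti_le h.hb (by omega)
      have s3 := h.ha i
      have s4 := h.h1
      have s5 : T (i + 1) j ≠ 0 := (h.sup _ _).2 (by omega)
      have s6 := h.pf.2.2 k j (i + 1) j (by omega) le_rfl s5 hT
      omega
    refine ⟨?_, ?_, ?_⟩
    · intro a b hab
      rw [mv_apply] at hab
      split_ifs at hab with g1 g2
      · obtain ⟨rfl, rfl⟩ := g1
        exact ⟨h.h2, by have := h.h1; unfold YCell; omega⟩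
      · omega
      · exact h.pf.1 a b hab
    · intro a a' b haa
      simp only [mv_apply]
      by_cases e1 : a = i ∧ b = j
      · obtain ⟨rfl, rfl⟩ := e1
        rw [if_pos ⟨rfl, rfl⟩, if_neg (by omega), if_neg (by omega)]
        intro _ q; exact key2 a' haa q
      · rw [if_neg e1]
        by_cases e2 : a = i ∧ b = j + 1
        · rw [if_pos e2]; simp
        · rw [if_neg e2]
          by_cases e3 : a' = i ∧ b = j
          · obtain ⟨rfl, rfl⟩ := e3
            rw [if_pos ⟨rfl, rfl⟩]
            intro q _; exact key1 a haa q
          · rw [if_neg e3]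
            by_cases e4 : a' = i ∧ b = j + 1
            · rw [if_pos e4]; simp
            · rw [if_neg e4]; exact h.pf.2.1 _ _ _ haa
    · intro a b a' b' haa hbb
      simp only [mv_apply]
      by_cases e1 : a' = i ∧ b' = j
      · obtain ⟨rfl, rfl⟩ := e1
        rw [if_pos ⟨rfl, rfl⟩]
        split_ifs with g1 g2
        · simp
        · simp
        · intro _ q
          by_cases g3 : b' + 1 ≤ b
          · exact h.pf.2.2 _ _ _ _ haa g3 hr q
          · have : b = b' := by omega
            subst this
            exact (key2 a (by omega) q).le
      · rw [if_neg e1]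
        by_cases e2 : a' = i ∧ b' = j + 1
        · rw [if_pos e2]; simp
        · rw [if_neg e2]
          by_cases e3 : a = i ∧ b = j
          · obtain ⟨rfl, rfl⟩ := e3
            rw [if_pos ⟨rfl, rfl⟩]
            intro q _
            exact h.pf.2.2 _ _ _ _ haa (by omega) q hr
          · rw [if_neg e3]
            split_ifs with g
            · simp
            · exact h.pf.2.2 _ _ _ _ haa hbb

lemma SL.down {be al T i j} (h : SL be al T i j) (hd : T (i + 1) j ≠ 0)
    (hr : T i (j + 1) = 0 ∨ T (i + 1) j ≤ T i (j + 1)) :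
    SL be al (mv T (i + 1) j i j) (i + 1) j := by
  have sr := (h.sup _ _).1 hd
  have hz := h.zero
  refine ⟨h.hb, h.ha, sr.1, sr.2.1, ?_, ?_⟩
  · intro a b
    rw [mv_apply]
    split_ifs with g1 g2
    · obtain ⟨rfl, rfl⟩ := g1
      have := h.h1
      have := h.h2
      simp [hd]; omega
    · simp; omega
    · rw [h.sup]; omega
  · have key2 : ∀ l, j < l → T i l ≠ 0 → T (i + 1) j ≤ T i l := by
      intro k hk hT
      have s1 := (h.sup _ _).1 hT
      have s4 := h.h1
      have s5 : T i (j + 1) ≠ 0 := (h.sup _ _).2 (by omega)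
      have s6 := h.pf.2.2 i k i (j + 1) le_rfl (by omega) s5 hT
      omega
    refine ⟨?_, ?_, ?_⟩
    · intro a b hab
      rw [mv_apply] at hab
      split_ifs at hab with g1 g2
      · obtain ⟨rfl, rfl⟩ := g1
        exact ⟨h.h2, by have := h.h1; unfold YCell; omega⟩
      · omega
      · exact h.pf.1 a b hab
    · intro a a' b haa
      simp only [mv_apply]
      by_cases e1 : a = i ∧ b = j
      · obtain ⟨rfl, rfl⟩ := e1
        rw [if_pos ⟨rfl, rfl⟩, if_neg (by omega)]
        split_ifs with g
        · simp
        · intro _ q; exact h.pf.2.1 _ _ _ (by omega) hd q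
      · rw [if_neg e1]
        by_cases e2 : a = i + 1 ∧ b = j
        · rw [if_pos e2]; simp
        · rw [if_neg e2]
          by_cases e3 : a' = i ∧ b = j
          · obtain ⟨rfl, rfl⟩ := e3
            rw [if_pos ⟨rfl, rfl⟩]
            intro q _; exact h.pf.2.1 _ _ _ (by omega) q hd
          · rw [if_neg e3]
            split_ifs with g
            · simp
            · exact h.pf.2.1 _ _ _ haa
    · intro a b a' b' haa hbb
      simp only [mv_apply]
      by_cases e1 : a' = i ∧ b' = j
      · obtain ⟨rfl, rfl⟩ := e1
        rw [if_pos ⟨rfl, rfl⟩]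
        split_ifs with g1 g2
        · simp
        · simp
        · intro _ q
          by_cases g3 : a' + 1 ≤ a
          · exact h.pf.2.2 _ _ _ _ g3 hbb hd q
          · have : a = a' := by omega
            subst this
            exact key2 b (by omega) q
      · rw [if_neg e1]
        by_cases e2 : a' = i + 1 ∧ b' = j
        · rw [if_pos e2]; simp
        · rw [if_neg e2]
          by_cases e3 : a = i ∧ b = j
          · obtain ⟨rfl, rfl⟩ := e3
            rw [if_pos ⟨rfl, rfl⟩]
            intro q _
            exact h.pf.2.2 _ _ _ _ (by omega) hbb q hd
          · rw [if_neg e3]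
            split_ifs with g
            · simp
            · exact h.pf.2.2 _ _ _ _ haa hbb

lemma SL.kn_down {be al T i j n L} (h : SL be al T i j) (hd : T (i + 1) j ≠ 0)
    (hr : T i (j + 1) = 0 ∨ T (i + 1) j ≤ T i (j + 1)) (hL : i + 1 < L) (hn : j < n) :
    Kn (wd n L T) (wd n L (mv T (i + 1) j i j)) := by
  have sd := (h.sup _ _).1 hd
  have b1 := h.hb i
  have a1 := h.ha i
  have h1 := h.h1
  refine wd_vert h.pf (h.down hd hr).pf hL hn hd h.zero ?_ ?_ ?_
  · intro c hc g
    have := (h.sup _ _).1 g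
    exact (h.sup _ _).2 (by omega)
  · intro c hc g
    have := (h.sup _ _).1 g
    exact (h.sup _ _).2 (by omega)
  · intro c hc g
    have := (h.sup _ _).1 g
    exact (h.sup _ _).2 (by omega)

lemma ssyt_perf {be al T} (hb : ∀ i, be (i + 1) ≤ be i) (h : IsSkewSSYT be al T) :
    IsPerforated (SkewYCell be al) T := by
  refine ⟨fun i j => (h.1 i j).1, ?_, ?_⟩
  · intro i i' j hi h1 h2
    exact h.2.2 i i' j hi ((h.1 _ _).1 h1) ((h.1 _ _).1 h2)
  · intro i j i' j' hi hj h1 h2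
    have s1 := (h.1 _ _).1 h1
    have s2 := (h.1 _ _).1 h2
    have s3 : be i ≤ be i' := anti_le hb hi
    have s4 : SkewYCell be al i' j := by
      simp only [SkewYCell, YCell] at *; omega
    have t1 := h.2.1 i' j' j hj s1 s4
    rcases Nat.eq_or_lt_of_le hi with e | e
    · subst e; exact t1
    · exact t1.trans (h.2.2 i' i j e s4 s2).le

lemma perf_ssyt {γ : ℕ → ℕ → Prop} {be al T} (h : IsPerforated γ T)
    (hs : ∀ i j, T i j ≠ 0 ↔ SkewYCell be al i j) : IsSkewSSYT be al T :=
  ⟨hs, fun i j j' hj h1 h2 => h.2.2 _ _ _ _ le_rfl hj ((hs _ _).2 h1) ((hs _ _).2 h2),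
    fun i i' j hi h1 h2 => h.2.1 _ _ _ hi ((hs _ _).2 h1) ((hs _ _).2 h2)⟩

/-- The result of a slide. -/
structure SR (n L : ℕ) (be al : ℕ → ℕ) (T T' : ℕ → ℕ → ℕ) (be' : ℕ → ℕ) : Prop where
  anti : ∀ i, be' (i + 1) ≤ be' i
  le : ∀ i, be' i ≤ be i
  ge : ∀ i, al i ≤ be i → al i ≤ be' i
  tab : IsSkewSSYT be' al T'
  kn : Kn (wd n L T) (wd n L T')

lemma slide_ok {n L n0 L0 : ℕ} {be al : ℕ → ℕ} (hn : n0 ≤ n) (hL : L0 ≤ L)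
    (hb1 : ∀ i, be i ≤ n0) (hb2 : ∀ i, L0 ≤ i → be i = 0) :
    ∀ (fuel : ℕ) (T : ℕ → ℕ → ℕ) (i j : ℕ), SL be al T i j → (L0 - i) + (n0 - j) ≤ fuel →
      ∃ be', SR n L be al T (slideAux fuel T i j) be'
  | 0, T, i, j, h, hf => by
    have h2 := h.h2
    have := hb1 i
    omega
  | fuel + 1, T, i, j, h, hf => by
    have h2 := h.h2
    have h1 := h.h1
    have b1 := hb1 i
    have i1 : i < L0 := by
      by_contra hc
      have := hb2 i (by omega)
      omega
    rw [slideAux]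
    split_ifs with g1 g2
    · obtain ⟨g1, g2⟩ := g1
      have s1 := h.sup i (j + 1)
      have s2 := h.sup (i + 1) j
      have a1 := h.ha i
      refine ⟨fun a => if a = i then j else be a, ?_, ?_, ?_, ?_, Kn.refl _⟩
      · intro a
        have := h.hb a
        split_ifs with e1 e2 e2
        · omega
        · subst e1; omega
        · subst e2; omega
        · exact this
      · intro a
        split_ifs with e
        · subst e; omega
        · exact le_rfl
      · intro a ha
        split_ifs with e
        · subst e; omega
        · exact ha
      · refine perf_ssyt h.pf ?_
        intro a b
        rw [h.sup]
        simp only [SkewYCell, YCell]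
        split_ifs with e
        · subst e; omega
        · omega
    · have hr : T i (j + 1) ≠ 0 := by omega
      rw [mv_eq_upd T (by omega)]
      have sr := (h.sup _ _).1 hr
      obtain ⟨be', k1, k2, k3, k4, k5⟩ := slide_ok hn hL hb1 hb2 fuel _ i (j + 1)
        (h.right hr (by omega)) (by omega)
      refine ⟨be', k1, k2, k3, k4, ?_⟩
      rwa [wd_horiz (by omega) h.zero] at k5
    · have hd : T (i + 1) j ≠ 0 := by omega
      rw [mv_eq_upd T (by omega)]
      have sr := (h.sup _ _).1 hd
      have i2 : i + 1 < L0 := by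
        by_contra hc
        have := hb2 (i + 1) (by omega)
        omega
      obtain ⟨be', k1, k2, k3, k4, k5⟩ := slide_ok hn hL hb1 hb2 fuel _ (i + 1) j
        (h.down hd (by omega)) (by omega)
      exact ⟨be', k1, k2, k3, k4, (h.kn_down hd (by omega) (by omega) (by omega)).trans k5⟩

lemma find_last (P : ℕ → Bool) : ∀ n,
    (∀ r, (List.range n).reverse.find? P = some r →
      r < n ∧ P r = true ∧ ∀ k, r < k → k < n → P k = false) ∧
    ((List.range n).reverse.find? P = none → ∀ k, k < n → P k = false)
  | 0 => by simp
  | n + 1 => by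
    obtain ⟨ih1, ih2⟩ := find_last P n
    rw [List.range_succ, List.reverse_append, List.reverse_singleton, List.singleton_append,
      List.find?_cons]
    cases hP : P n with
    | true =>
      simp only
      refine ⟨fun r hr => ?_, by simp⟩
      have hr : n = r := by simpa using hr
      subst hr
      exact ⟨by omega, hP, fun k k1 k2 => by omega⟩
    | false =>
      simp only
      constructor
      · intro r hr
        obtain ⟨h1, h2, h3⟩ := ih1 r hr
        refine ⟨by omega, h2, fun k k1 k2 => ?_⟩
        by_cases hk : k = n
        · rw [hk]; exact hP
        · exact h3 k k1 (by omega)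
      · intro hr k hk
        by_cases hk : k = n
        · rw [hk]; exact hP
        · exact ih2 hr k (by omega)

lemma sum_set_pred : ∀ (m : List ℕ) (r : ℕ), m.getD r 0 ≠ 0 →
    (m.set r (m.getD r 0 - 1)).sum + 1 = m.sum
  | [], r, h => by simp at h
  | a :: m, 0, h => by
    simp at h ⊢; omega
  | a :: m, r + 1, h => by
    have := sum_set_pred m r (by simpa using h)
    simp only [List.getD_cons_succ, List.set_cons_succ, List.sum_cons]
    omega

lemma getD_le_sum : ∀ (m : List ℕ) (r : ℕ), m.getD r 0 ≤ m.sum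
  | [], r => by simp
  | a :: m, 0 => by simp
  | a :: m, r + 1 => by
    have := getD_le_sum m r
    simp only [List.getD_cons_succ, List.sum_cons]
    omega

lemma getD_set (m : List ℕ) (r v i : ℕ) (hr : r < m.length) :
    (m.set r v).getD i 0 = if i = r then v else m.getD i 0 := by
  simp only [List.getD_eq_getElem?_getD, List.getElem?_set]
  by_cases h : r = i
  · subst h; simp [hr]
  · rw [if_neg h, if_neg (Ne.symm h)]

lemma rect_ok {n L n0 L0 B : ℕ} (hn : n0 ≤ n) (hL : L0 ≤ L) (hB : L0 + n0 ≤ B) :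
    ∀ (steps : ℕ) (m : List ℕ) (be : ℕ → ℕ) (T : ℕ → ℕ → ℕ), m.sum ≤ steps →
      (∀ i, be (i + 1) ≤ be i) → (∀ i, m.getD (i + 1) 0 ≤ m.getD i 0) →
      (∀ i, m.getD i 0 ≤ be i) →
      (∀ i, be i ≤ n0) → (∀ i, L0 ≤ i → be i = 0) → IsSkewSSYT be (fun i => m.getD i 0) T →
      ∃ be', SR n L be (fun _ => 0) T (rectSteps B steps m T) be'
  | 0, m, be, T, hm, hb, ha, hab, hb1, hb2, hT => by
    have e : (fun i => m.getD i 0) = fun _ => 0 := by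
      funext i; have := getD_le_sum m i; omega
    rw [e] at hT
    exact ⟨be, hb, fun _ => le_rfl, fun _ h => h, hT, Kn.refl _⟩
  | steps + 1, m, be, T, hm, hb, ha, hab, hb1, hb2, hT => by
    have FL := find_last (fun i => decide (m.getD i 0 ≠ 0)) m.length
    rw [rectSteps]
    cases hl : lastPos m with
    | none =>
      have e : (fun i => m.getD i 0) = fun _ => 0 := by
        funext i
        by_cases hi : i < m.length
        · have := FL.2 hl i hi
          simpa using this
        · rw [List.getD_eq_default _ _ (by omega)]
      rw [e] at hT
      exact ⟨be, hb, fun _ => le_rfl, fun _ h => h, hT, Kn.refl _⟩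
    | some r =>
      obtain ⟨r1, r2, r3⟩ := FL.1 r hl
      have r2 : m.getD r 0 ≠ 0 := by simpa using r2
      have r4 : ∀ k, r < k → m.getD k 0 = 0 := by
        intro k hk
        by_cases hi : k < m.length
        · have := r3 k hk hi
          simpa using this
        · rw [List.getD_eq_default _ _ (by omega)]
      simp only
      have gs := fun i => getD_set m r (m.getD r 0 - 1) i r1
      have hs := sum_set_pred m r r2
      obtain ⟨m', hm'⟩ : ∃ m', m.set r (m.getD r 0 - 1) = m' := ⟨_, rfl⟩
      rw [hm'] at hs ⊢
      simp only [hm'] at gs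
      have ha' : ∀ i, m'.getD (i + 1) 0 ≤ m'.getD i 0 := by
        intro i
        rw [gs, gs]
        have := ha i
        split_ifs with e1 e2 e2
        · omega
        · subst e1; omega
        · subst e2; have := r4 (i + 1) (by omega); omega
        · exact this
      have hT0 : ∀ i j, T i j ≠ 0 ↔ (m.getD i 0 ≤ j ∧ j < be i) := by
        intro i j; rw [hT.1]; simp only [SkewYCell, YCell]; omega
      have sl : SL be (fun i => m'.getD i 0) T r (m.getD r 0 - 1) := by
        refine ⟨hb, ha', ?_, ?_, ?_, ?_⟩
        · rw [gs, if_pos rfl]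
        · have := hab r; omega
        · intro a b
          rw [hT0]
          rw [gs]
          split_ifs with e
          · subst e
            have := hab a
            omega
          · omega
        · have pf := ssyt_perf hb hT
          refine ⟨?_, pf.2⟩
          intro i j hij
          have h1 := (hT0 i j).1 hij
          simp only [SkewYCell, YCell]
          rw [gs]
          split_ifs with e
          · subst e; omega
          · omega
      obtain ⟨be', k1, k2, k3, k4, k5⟩ := slide_ok hn hL hb1 hb2 B T r _ sl (by omega)
      have hab' : ∀ i, m'.getD i 0 ≤ be' i := by
        intro i
        refine k3 i ?_
        rw [gs]
        have := hab i
        split_ifs with e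
        · subst e; omega
        · exact this
      obtain ⟨be'', l1, l2, l3, l4, l5⟩ := rect_ok hn hL hB steps m' be' _ (by omega) k1 ha' hab'
        (fun i => (k2 i).trans (hb1 i)) (fun i hi => by have := k2 i; have := hb2 i hi; omega) k4
      exact ⟨be'', l1, fun i => (l2 i).trans (k2 i), fun i _ => Nat.zero_le _, l4, k5.trans l5⟩

lemma len_spec {p : ℕ → ℕ} (h : IsPartitionFun p) : ∀ i, p i ≠ 0 ↔ i < len p := by
  classical
  obtain ⟨h1, h2⟩ := h
  have e : {i | p i ≠ 0} = (Finset.range (Nat.find h2) : Set ℕ) := by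
    ext i
    simp only [Set.mem_ofPred_eq, Finset.coe_range, Set.mem_Iio]
    constructor
    · intro hi
      by_contra hc
      have := anti_le h1 (show Nat.find h2 ≤ i by omega)
      have := Nat.find_spec h2
      omega
    · intro hi; exact Nat.find_min h2 hi
  have e2 : len p = Nat.find h2 := by
    rw [len, e, Set.ncard_coe_finset, Finset.card_range]
  intro i
  rw [e2]
  have : i ∈ {i | p i ≠ 0} ↔ i ∈ (Finset.range (Nat.find h2) : Set ℕ) := by rw [e]
  simpa using this

lemma size_spec {p : ℕ → ℕ} (h : IsPartitionFun p) : (muList p).sum = size p := by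
  have hl := len_spec h
  rw [size, finsum_eq_finsetSum_of_support_subset (s := Finset.range (len p))]
  · rfl
  · intro i hi
    simpa using (hl i).1 hi

lemma muList_getD {p : ℕ → ℕ} (h : IsPartitionFun p) (i : ℕ) : (muList p).getD i 0 = p i := by
  have hl := len_spec h i
  rw [muList, List.getD_eq_getElem?_getD]
  by_cases hi : i < len p
  · simp [hi]
  · have : p i = 0 := by omega
    rw [List.getElem?_eq_none (by simp; omega)]
    simp [this]

lemma fin_bound (T : ℕ → ℕ → ℕ) (n L : ℕ) (h : ∀ i j, T i j ≠ 0 → i < L ∧ j < n) :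
    ∃ N, ∀ i j, T i j < N := by
  refine ⟨(∑ i ∈ Finset.range L, ∑ j ∈ Finset.range n, T i j) + 1, ?_⟩
  intro i j
  by_cases h0 : T i j = 0
  · omega
  · obtain ⟨h1, h2⟩ := h i j h0
    have a1 : T i j ≤ ∑ j ∈ Finset.range n, T i j :=
      Finset.single_le_sum (f := fun j => T i j) (fun _ _ => Nat.zero_le _) (by simpa using h2)
    have a2 : ∑ j ∈ Finset.range n, T i j ≤ ∑ i ∈ Finset.range L, ∑ j ∈ Finset.range n, T i j :=
      Finset.single_le_sum (f := fun i => ∑ j ∈ Finset.range n, T i j)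
        (fun _ _ => Nat.zero_le _) (by simpa using h1)
    omega

lemma RectOf_ok {n L : ℕ} {nu mu : ℕ → ℕ} {T : ℕ → ℕ → ℕ} (hnu : IsPartitionFun nu)
    (hmu : IsPartitionFun mu) (hle : ∀ i, mu i ≤ nu i) (hT : IsSkewSSYT nu mu T)
    (hn : nu 0 ≤ n) (hL : len nu ≤ L) :
    ∃ be, SR n L nu (fun _ => 0) T (RectOf nu mu T) be := by
  have e : (fun i => (muList mu).getD i 0) = mu := funext (muList_getD hmu)
  refine rect_ok (n0 := nu 0) (L0 := len nu) hn hL (by omega) _ _ nu T (size_spec hmu).le hnu.1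
    ?_ ?_ ?_ ?_ ?_
  · intro i; rw [muList_getD hmu, muList_getD hmu]; exact hmu.1 i
  · intro i; rw [muList_getD hmu]; exact hle i
  · intro i; exact anti_le hnu.1 (by omega)
  · intro i hi
    have := len_spec hnu i
    omega
  · rw [e]; exact hT

lemma straight_strt {n : ℕ} {be : ℕ → ℕ} {T : ℕ → ℕ → ℕ} (hb : ∀ i, be (i + 1) ≤ be i)
    (hT : IsSkewSSYT be (fun _ => 0) T) : Strt n T := by
  have pf := ssyt_perf hb hT
  have hs : ∀ i j, T i j ≠ 0 ↔ j < be i := by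
    intro i j; rw [hT.1]; simp only [SkewYCell, YCell]; omega
  refine ⟨fun i c c' hc h1 h2 => pf.2.2 _ _ _ _ le_rfl hc h1 h2, fun i => row_dom _ _ _ ?_ ?_⟩
  · intro c hc
    have h1 := (hs _ _).1 hc
    have h2 := hb i
    have h3 := (hs i c).2 (by omega)
    exact ⟨h3, pf.2.1 _ _ _ (by omega) h3 hc⟩
  · intro c hc
    have h1 := (hs _ _).1 hc
    exact (hs _ c).2 (by omega)

lemma rect_eq {n L : ℕ} {nu mu nu' mu' : ℕ → ℕ} {T T' : ℕ → ℕ → ℕ}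
    (hnu : IsPartitionFun nu) (hmu : IsPartitionFun mu) (hle : ∀ i, mu i ≤ nu i)
    (hT : IsSkewSSYT nu mu T)
    (hnu' : IsPartitionFun nu') (hmu' : IsPartitionFun mu') (hle' : ∀ i, mu' i ≤ nu' i)
    (hT' : IsSkewSSYT nu' mu' T') (hn : nu 0 ≤ n) (hL : len nu ≤ L)
    (hn' : nu' 0 ≤ n) (hL' : len nu' ≤ L) (hk : Kn (wd n L T) (wd n L T')) :
    RectOf nu mu T = RectOf nu' mu' T' := by
  obtain ⟨be, a1, a2, a3, a4, a5⟩ := RectOf_ok hnu hmu hle hT hn hL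
  obtain ⟨be', b1, b2, b3, b4, b5⟩ := RectOf_ok hnu' hmu' hle' hT' hn' hL'
  have sa : ∀ i j, RectOf nu mu T i j ≠ 0 ↔ j < be i := by
    intro i j; rw [a4.1]; simp only [SkewYCell, YCell]; omega
  have sb : ∀ i j, RectOf nu' mu' T' i j ≠ 0 ↔ j < be' i := by
    intro i j; rw [b4.1]; simp only [SkewYCell, YCell]; omega
  have an : ∀ i, be i ≤ n := fun i =>
    (a2 i).trans ((anti_le hnu.1 (Nat.zero_le i)).trans hn)
  have bn : ∀ i, be' i ≤ n := fun i =>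
    (b2 i).trans ((anti_le hnu'.1 (Nat.zero_le i)).trans hn')
  have aL : ∀ i, L ≤ i → be i = 0 := fun i hi => by
    have := a2 i; have := len_spec hnu i; omega
  have bL : ∀ i, L ≤ i → be' i = 0 := fun i hi => by
    have := b2 i; have := len_spec hnu' i; omega
  obtain ⟨N1, hN1⟩ := fin_bound (RectOf nu mu T) n L (fun i j h => by
    have h1 := (sa i j).1 h
    have h2 := an i
    refine ⟨?_, by omega⟩
    by_contra hc
    have := aL i (by omega)
    omega)
  obtain ⟨N2, hN2⟩ := fin_bound (RectOf nu' mu' T') n L (fun i j h => by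
    have h1 := (sb i j).1 h
    have h2 := bn i
    refine ⟨?_, by omega⟩
    by_contra hc
    have := bL i (by omega)
    omega)
  have key := strt_unique (N := N1 + N2) (n := n) L _ _ (straight_strt a1 a4) (straight_strt b1 b4)
    (fun i j => by have := hN1 i j; omega) (fun i j => by have := hN2 i j; omega)
    (fun i hi c => by
      have h1 := sa i c
      have h2 := aL i hi
      omega)
    (fun i hi c => by
      have h1 := sb i c
      have h2 := bL i hi
      omega) (a5.symm.trans (hk.trans b5))
  funext i c
  rw [row_prefix n (be i) _ (an i) (sa i) c, row_prefix n (be' i) _ (bn i) (sb i) c, key i]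


/-- Distinct nonzero entries. -/
def Inj2 (F : ℕ → ℕ → ℕ) : Prop := ∀ i j k l, F i j ≠ 0 → F i j = F k l → i = k ∧ j = l

lemma Inj2.mv {F : ℕ → ℕ → ℕ} (h : Inj2 F) {i j k l : ℕ} (hF : F i j ≠ 0) :
    Inj2 (mv F i j k l) := by
  intro a b c d h1 h2
  have h3 : SLR.mv F i j k l c d ≠ 0 := by rw [← h2]; exact h1
  rcases mv_ne h1 with ⟨e1, e2, e3⟩ | ⟨e1, e2, e3⟩ <;>
  rcases mv_ne h3 with ⟨f1, f2, f3⟩ | ⟨f1, f2, f3⟩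
  · omega
  · rw [e3, f3] at h2
    have := h _ _ _ _ hF h2
    omega
  · rw [e3, f3] at h2
    rw [e3] at h1
    have := h _ _ _ _ h1 h2
    omega
  · rw [e3, f3] at h2
    rw [e3] at h1
    exact h _ _ _ _ h1 h2

lemma rho1_lt {A B a b a' b' : ℕ} (ha : a ≤ A) (ha' : a' ≤ A) (hb : b ≤ B) (hb' : b' ≤ B)
    (hne : a' ≠ a) : rho1 A B a' b' < rho1 A B a b ↔ a < a' := by
  rcases Nat.lt_or_gt_of_ne hne with h | h
  · have : rho1 A B a b < rho1 A B a' b' := lex_lt (by omega) (by omega)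
    omega
  · have : rho1 A B a' b' < rho1 A B a b := lex_lt (by omega) (by omega)
    omega

lemma rho2_lt {A a b a' b' : ℕ} (hne : b' ≠ b) : rho2 A a' b' < rho2 A a b ↔ b' < b := by
  rcases Nat.lt_or_gt_of_ne hne with h | h
  · have : rho2 A a' b' < rho2 A a b := lex_lt (by omega) h
    omega
  · have : rho2 A a b < rho2 A a' b' := lex_lt (by omega) h
    omega

section
variable {γ : ℕ → ℕ → Prop} {N A B : ℕ}

lemma inv1_step (hc : Cvx γ) (hN : ∀ i j, γ i j → i < N ∧ j < N) (W : List ℕ) :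
    ∀ a b p i j k l, SG γ A B (fun a' b' => rho1 A B a' b' < rho1 A B a b) a b p →
      ((k = i ∧ l = j + 1) ∨ (k = i + 1 ∧ l = j)) → a ≠ 0 → b ≠ 0 →
      p.1 i j = a → p.2 k l = b →
      SG γ A B (fun a' b' => rho1 A B a' b' < rho1 A B a b) a b (sw p i j k l) →
      (Inj2 p.1 ∧ Kn (wd N N p.2) W) →
      Inj2 (sw p i j k l).1 ∧ Kn (wd N N (sw p i j k l).2) W := by
  intro a b p i j k l h hm ha hb h1 h2 h' ⟨hI, hk⟩
  have p1 : p.1 i j ≠ 0 := by omega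
  have p2 : p.2 k l ≠ 0 := by omega
  refine ⟨hI.mv p1, ?_⟩
  have g1 := h.pf1.1 _ _ p1
  have g2 := h.pf2.1 _ _ p2
  have n2 := hN _ _ g2
  have z : p.2 i j = 0 := by have := h.dj i j; omega
  have bA : a ≤ A := by rw [← h1]; exact h.bd1 _ _
  have bB : b ≤ B := by rw [← h2]; exact h.bd2 _ _
  show Kn (wd N N (mv p.2 k l i j)) W
  rcases hm with ⟨rfl, rfl⟩ | ⟨rfl, rfl⟩
  · rwa [wd_horiz n2.2 z]
  · -- entries of `S` different from the moving one
    have st : ∀ x y u v, x ≤ u → y ≤ v → ¬ (x = i ∧ y = l) → p.1 x y ≠ 0 → p.2 u v ≠ 0 →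
        p.1 x y < a := by
      intro x y u v hu hv hne q1 q2
      have hn : p.1 x y ≠ a := by
        intro e
        have := hI x y i l q1 (by rw [e, h1])
        omega
      rcases h.st x y u v hu hv q1 q2 with e | e
      · omega
      · rw [rho1_lt bA (h.bd1 _ _) bB (h.bd2 _ _) hn] at e
        omega
    have fz : ∀ x y, γ x y → p.2 x y = 0 → p.1 x y ≠ 0 := by
      intro x y q1 q2
      have := h.fill x y q1
      omega
    refine (Kn.symm (wd_vert h.pf2 h'.pf2 n2.1 n2.2 p2 z ?_ ?_ ?_)).trans hk
    · intro c hcj q1 q0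
      have gc := hc _ _ _ _ (i + 1) c (h.pf2.1 _ _ q1) g2 (by omega) le_rfl le_rfl (by omega)
      have q2 := fz _ _ gc q0
      have r1 := st (i + 1) c (i + 1) l le_rfl (by omega) (by omega) q2 p2
      rcases h.ts i c (i + 1) c (by omega) le_rfl q1 q2 with e | e
      · omega
      · rw [rho1_lt bA (h.bd1 _ _) bB (h.bd2 _ _) (by omega)] at e
        omega
    · intro c hcj q1 q0
      have gc := hc _ _ _ _ i c g1 (h.pf2.1 _ _ q1) le_rfl (by omega) (by omega) le_rfl
      have q2 := fz _ _ gc q0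
      have r1 := st i c (i + 1) c (by omega) le_rfl (by omega) q2 q1
      have r2 := h.pf1.2.2 i c i l le_rfl (by omega) p1 q2
      omega
    · intro c hcj q1 q0
      have gc := hc _ _ _ _ (i + 1) c g1 (h.pf2.1 _ _ q1) (by omega) le_rfl (by omega) (by omega)
      have q2 := fz _ _ gc q0
      have r1 := st (i + 1) c (i + 1) (c + 1) le_rfl (by omega) (by omega) q2 q1
      have r2 := h.pf1.2.2 (i + 1) c i l (by omega) (by omega) p1 q2
      omega

lemma mv_mv (F : ℕ → ℕ → ℕ) {i j k l : ℕ} (h : F k l = 0) :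
    mv (mv F i j k l) k l i j = F := by
  funext a b
  rw [mv_apply]
  by_cases h1 : a = i ∧ b = j
  · rw [if_pos h1, mv_apply, if_pos ⟨rfl, rfl⟩, h1.1, h1.2]
  · rw [if_neg h1]
    by_cases h2 : a = k ∧ b = l
    · rw [if_pos h2, h2.1, h2.2, h]
    · rw [if_neg h2, mv_apply, if_neg h2, if_neg h1]

lemma inv2_step (hc : Cvx γ) (hN : ∀ i j, γ i j → i < N ∧ j < N) (W : List ℕ) :
    ∀ a b p i j k l, SG γ A B (fun a' b' => rho2 A a' b' < rho2 A a b) a b p →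
      ((k = i ∧ l = j + 1) ∨ (k = i + 1 ∧ l = j)) → a ≠ 0 → b ≠ 0 →
      p.1 i j = a → p.2 k l = b →
      SG γ A B (fun a' b' => rho2 A a' b' < rho2 A a b) a b (sw p i j k l) →
      (Inj2 p.2 ∧ Kn (wd N N p.1) W) →
      Inj2 (sw p i j k l).2 ∧ Kn (wd N N (sw p i j k l).1) W := by
  intro a b p i j k l h' hm ha hb h1' h2' h ⟨hI', hk⟩
  have p1' : p.1 i j ≠ 0 := by omega
  have p2' : p.2 k l ≠ 0 := by omega
  have hI : Inj2 (sw p i j k l).2 := hI'.mv p2'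
  refine ⟨hI, ?_⟩
  have z' : p.1 k l = 0 := by have := h'.dj k l; omega
  have hback : mv (sw p i j k l).1 k l i j = p.1 := mv_mv _ z'
  have h1 : (sw p i j k l).1 k l = a := by rw [sw1_apply, if_pos ⟨rfl, rfl⟩, h1']
  have h2 : (sw p i j k l).2 i j = b := by rw [sw2_apply, if_pos ⟨rfl, rfl⟩, h2']
  have hpf := h'.pf1
  rw [← hback] at hk hpf
  clear hback hI' h1' h2' p1' p2' z' h'
  generalize hq : sw p i j k l = q at *
  clear hq
  have p1 : q.1 k l ≠ 0 := by omega
  have p2 : q.2 i j ≠ 0 := by omega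
  have g1 := h.pf1.1 _ _ p1
  have g2 := h.pf2.1 _ _ p2
  have n1 := hN _ _ g1
  have z : q.1 i j = 0 := by have := h.dj i j; omega
  rcases hm with ⟨rfl, rfl⟩ | ⟨rfl, rfl⟩
  · rwa [wd_horiz n1.2 z] at hk
  · have ts : ∀ x y u v, x ≤ u → y ≤ v → ¬ (x = i ∧ y = l) → q.2 x y ≠ 0 → q.1 u v ≠ 0 →
        q.2 x y < b := by
      intro x y u v hu hv hne q1 q2
      have hn : q.2 x y ≠ b := by
        intro e
        have := hI x y i l q1 (by rw [e, h2])
        omega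
      rcases h.ts x y u v hu hv q1 q2 with e | e
      · omega
      · rw [rho2_lt hn] at e
        omega
    have fz : ∀ x y, γ x y → q.1 x y = 0 → q.2 x y ≠ 0 := by
      intro x y q1 q2
      have := h.fill x y q1
      omega
    refine (wd_vert h.pf1 hpf n1.1 n1.2 p1 z ?_ ?_ ?_).trans hk
    · intro c hcj q1 q0
      have gc := hc _ _ _ _ (i + 1) c (h.pf1.1 _ _ q1) g1 (by omega) le_rfl le_rfl (by omega)
      have q2 := fz _ _ gc q0
      have r1 := ts (i + 1) c (i + 1) l le_rfl (by omega) (by omega) q2 p1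
      rcases h.st i c (i + 1) c (by omega) le_rfl q1 q2 with e | e
      · omega
      · rw [rho2_lt (by omega)] at e
        omega
    · intro c hcj q1 q0
      have gc := hc _ _ _ _ i c g2 (h.pf1.1 _ _ q1) le_rfl (by omega) (by omega) le_rfl
      have q2 := fz _ _ gc q0
      have r1 := ts i c (i + 1) c (by omega) le_rfl (by omega) q2 q1
      have r2 := h.pf2.2.2 i c i l le_rfl (by omega) p2 q2
      omega
    · intro c hcj q1 q0
      have gc := hc _ _ _ _ (i + 1) c g2 (h.pf1.1 _ _ q1) (by omega) le_rfl (by omega) (by omega)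
      have q2 := fz _ _ gc q0
      have r1 := ts (i + 1) c (i + 1) (c + 1) le_rfl (by omega) (by omega) q2 q1
      have r2 := h.pf2.2.2 (i + 1) c i l (by omega) (by omega) p2 q2
      omega

/-- `G` is a refinement of the filling `F`, breaking ties by columns. -/
structure Lft (K : ℕ) (F G : ℕ → ℕ → ℕ) : Prop where
  dv : ∀ i j, G i j / K = F i j
  zr : ∀ i j, F i j = 0 → G i j = 0
  co : ∀ i j k l, F i j ≠ 0 → F i j = F k l → j < l → G i j < G k l

lemma Lft.ne {K F G} (h : Lft K F G) {i j : ℕ} : F i j ≠ 0 ↔ G i j ≠ 0 := by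
  constructor
  · intro h1 h2
    have := h.dv i j
    rw [h2] at this
    simp at this
    omega
  · intro h1 h2
    exact h1 (h.zr i j h2)

lemma Lft.lt {K F G} (h : Lft K F G) {i j k l : ℕ} (hlt : F i j < F k l) : G i j < G k l := by
  by_contra hc
  have := Nat.div_le_div_right (c := K) (show G k l ≤ G i j by omega)
  rw [h.dv, h.dv] at this
  omega

lemma Lft.perf {K F G} (h : Lft K F G) (hF : IsPerforated γ F) : IsPerforated γ G := by
  refine ⟨fun i j q => hF.1 i j (h.ne.2 q), ?_, ?_⟩
  · intro i i' j hi q1 q2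
    exact h.lt (hF.2.1 i i' j hi (h.ne.2 q1) (h.ne.2 q2))
  · intro i j i' j' hi hj q1 q2
    have q1' := h.ne.2 q1
    have q2' := h.ne.2 q2
    have := hF.2.2 i j i' j' hi hj q1' q2'
    rcases Nat.eq_or_lt_of_le this with e | e
    · rcases Nat.eq_or_lt_of_le hj with f | f
      · subst f
        rcases Nat.eq_or_lt_of_le hi with g | g
        · rw [g]
        · have := hF.2.1 i' i j' g q1' q2'
          omega
      · exact (h.co _ _ _ _ q1' e f).le
    · exact (h.lt e).le

lemma Lft.mv {K F G} (h : Lft K F G) {i j k l : ℕ} (hF : IsPerforated γ F)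
    (hF' : IsPerforated γ (mv F i j k l)) (h1 : F i j ≠ 0)
    (hadj : l = j ∨ l = j + 1 ∨ j = l + 1) :
    Lft K (mv F i j k l) (mv G i j k l) := by
  refine ⟨?_, ?_, ?_⟩
  · intro a b
    simp only [mv_apply]
    split_ifs
    · exact h.dv _ _
    · simp
    · exact h.dv _ _
  · intro a b
    simp only [mv_apply]
    split_ifs
    · exact h.zr _ _
    · simp
    · exact h.zr _ _
  · have colF : ∀ x y, ¬ (x = i ∧ y = j) → F x y = F i j → y ≠ j := by
      intro x y hne e hy
      subst hy
      rcases Nat.lt_trichotomy x i with g | g | g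
      · have := hF.2.1 x i y g (by omega) h1
        omega
      · omega
      · have := hF.2.1 i x y g h1 (by omega)
        omega
    have colF' : ∀ x y, ¬ (x = i ∧ y = j) → ¬ (x = k ∧ y = l) → F x y = F i j → y ≠ l := by
      intro x y hne hne' e hy
      subst hy
      have m1 : SLR.mv F i j k y x y = F x y := by rw [mv_apply, if_neg hne', if_neg hne]
      have m2 : SLR.mv F i j k y k y = F i j := by rw [mv_apply, if_pos ⟨rfl, rfl⟩]
      rcases Nat.lt_trichotomy x k with g | g | g
      · have := hF'.2.1 x k y g (by omega) (by omega)
        omega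
      · omega
      · have := hF'.2.1 k x y g (by omega) (by omega)
        omega
    intro a b c d q1 q2 hbd
    have q3 : SLR.mv F i j k l c d ≠ 0 := by rw [← q2]; exact q1
    have mg : ∀ x y, ¬ (x = k ∧ y = l) → ¬ (x = i ∧ y = j) → SLR.mv G i j k l x y = G x y := by
      intro x y g1 g2; rw [mv_apply, if_neg g1, if_neg g2]
    have mg' : SLR.mv G i j k l k l = G i j := by rw [mv_apply, if_pos ⟨rfl, rfl⟩]
    rcases mv_ne q1 with ⟨e1, e2, e3⟩ | ⟨e1, e2, e3⟩ <;>
    rcases mv_ne q3 with ⟨f1, f2, f3⟩ | ⟨f1, f2, f3⟩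
    · omega
    · rw [e3, f3] at q2
      rw [mg c d f1 f2, e1, e2, mg']
      have := colF c d f2 q2.symm
      have := colF' c d f2 f1 q2.symm
      exact h.co _ _ _ _ h1 q2 (by omega)
    · rw [e3, f3] at q2
      rw [mg a b e1 e2, f1, f2, mg']
      have := colF a b e2 q2
      have := colF' a b e2 e1 q2
      exact h.co _ _ _ _ (by omega) q2 (by omega)
    · rw [e3, f3] at q2
      rw [mg a b e1 e2, mg c d f1 f2]
      exact h.co _ _ _ _ (by rw [← e3]; exact q1) q2 hbd

lemma lift1 {K : ℕ} {p c : (ℕ → ℕ → ℕ) × (ℕ → ℕ → ℕ)} (hp : PP γ p)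
    (hr : Relation.ReflTransGen (SwitchStep γ) p c) {G : ℕ → ℕ → ℕ} (hG : Lft K p.1 G) :
    PP γ c ∧ ∃ G', Lft K c.1 G' ∧ Relation.ReflTransGen (SwitchStep γ) (G, p.2) (G', c.2) := by
  induction hr with
  | refl => exact ⟨hp, G, hG, .refl⟩
  | @tail x y _ hs ih =>
    obtain ⟨ih1, G', ih2, ih3⟩ := ih
    refine ⟨pp_step ih1 hs, ?_⟩
    obtain ⟨i, j, k, l, h1, h2, h3, rfl, h6, h7⟩ := step_iff.1 hs
    have hl := ih2.mv (i := i) (j := j) (k := k) (l := l) ih1.2.1 h6 h1 (by omega)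
    refine ⟨_, hl, ih3.tail (step_iff.2 ⟨i, j, k, l, ih2.ne.1 h1, h2, h3, rfl, ?_, h7⟩)⟩
    exact hl.perf h6

lemma lift2 {K : ℕ} {p c : (ℕ → ℕ → ℕ) × (ℕ → ℕ → ℕ)} (hp : PP γ p)
    (hr : Relation.ReflTransGen (SwitchStep γ) p c) {G : ℕ → ℕ → ℕ} (hG : Lft K p.2 G) :
    PP γ c ∧ ∃ G', Lft K c.2 G' ∧ Relation.ReflTransGen (SwitchStep γ) (p.1, G) (c.1, G') := by
  induction hr with
  | refl => exact ⟨hp, G, hG, .refl⟩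
  | @tail x y _ hs ih =>
    obtain ⟨ih1, G', ih2, ih3⟩ := ih
    refine ⟨pp_step ih1 hs, ?_⟩
    obtain ⟨i, j, k, l, h1, h2, h3, rfl, h6, h7⟩ := step_iff.1 hs
    have hl := ih2.mv (i := k) (j := l) (k := i) (l := j) ih1.2.2 h7 h2 (by omega)
    refine ⟨_, hl, ih3.tail (step_iff.2 ⟨i, j, k, l, h1, ih2.ne.1 h2, h3, rfl, h6, ?_⟩)⟩
    exact hl.perf h7

/-- Standardization. -/
def std (K : ℕ) (F : ℕ → ℕ → ℕ) : ℕ → ℕ → ℕ := fun i j => if F i j = 0 then 0 else F i j * K + j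

lemma std_lft {K : ℕ} {F : ℕ → ℕ → ℕ} (h : ∀ i j, F i j ≠ 0 → j < K) : Lft K F (std K F) := by
  refine ⟨?_, ?_, ?_⟩
  · intro i j
    unfold std
    split_ifs with h0
    · simp [h0]
    · have := h i j h0
      rw [Nat.mul_comm, Nat.mul_add_div (by omega), Nat.div_eq_of_lt this, Nat.add_zero]
  · intro i j h0; simp [std, h0]
  · intro i j k l h0 e hl
    unfold std
    rw [if_neg h0, if_neg (by omega), e]
    omega

lemma std_inj {K : ℕ} {F : ℕ → ℕ → ℕ} (hF : IsPerforated γ F) (h : ∀ i j, F i j ≠ 0 → j < K) :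
    Inj2 (std K F) := by
  have L := std_lft h
  intro i j k l h1 h2
  have g1 := L.ne.2 h1
  have g2 : F k l ≠ 0 := L.ne.2 (by rw [← h2]; exact h1)
  have e1 : F i j = F k l := by rw [← L.dv, ← L.dv, h2]
  unfold std at h2
  rw [if_neg g1, if_neg g2, e1] at h2
  have e2 : j = l := by omega
  subst e2
  refine ⟨?_, rfl⟩
  rcases Nat.lt_trichotomy i k with g | g | g
  · have := hF.2.1 i k j g g1 g2
    omega
  · exact g
  · have := hF.2.1 k i j g g2 g1
    omega

lemma sg_init {p : (ℕ → ℕ → ℕ) × (ℕ → ℕ → ℕ)} (hp : PP γ p)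
    (hf : ∀ i j, γ i j → p.1 i j ≠ 0 ∨ p.2 i j ≠ 0)
    (hs : ∀ i j k l, i ≤ k → j ≤ l → p.2 i j ≠ 0 → p.1 k l = 0)
    (h1 : ∀ i j, p.1 i j < A) (h2 : ∀ i j, p.2 i j < B) : SG γ A B (fun _ _ => False) 0 0 p :=
  ⟨hp.2.1, hp.2.2, hp.1, hf, fun i j => (h1 i j).le, fun i j => (h2 i j).le,
    fun _ _ _ _ _ _ _ _ => Or.inr id,
    fun i j k l hi hj q1 q2 => absurd (hs i j k l hi hj q1) q2⟩

lemma main_kn (hc : Cvx γ) (hN : ∀ i j, γ i j → i < N ∧ j < N)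
    {p c : (ℕ → ℕ → ℕ) × (ℕ → ℕ → ℕ)} (hp : PP γ p)
    (hf : ∀ i j, γ i j → p.1 i j ≠ 0 ∨ p.2 i j ≠ 0)
    (hs : ∀ i j k l, i ≤ k → j ≤ l → p.2 i j ≠ 0 → p.1 k l = 0)
    (hr : Relation.ReflTransGen (SwitchStep γ) p c) (ht : ∀ q, ¬ SwitchStep γ c q) :
    PP γ c ∧ (∀ i j, γ i j → c.1 i j ≠ 0 ∨ c.2 i j ≠ 0) ∧ Sorted2 c ∧
      Kn (wd N N c.1) (wd N N p.1) ∧ Kn (wd N N c.2) (wd N N p.2) := by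
  have bd : ∀ F : ℕ → ℕ → ℕ, IsPerforated γ F → ∃ M, ∀ i j, F i j < M := fun F hF =>
    fin_bound F N N (fun i j h => hN i j (hF.1 i j h))
  have k1 : ∀ i j, p.1 i j ≠ 0 → j < N := fun i j h => (hN i j (hp.2.1.1 i j h)).2
  have k2 : ∀ i j, p.2 i j ≠ 0 → j < N := fun i j h => (hN i j (hp.2.2.1 i j h)).2
  obtain ⟨A, hA⟩ := bd _ hp.2.1
  obtain ⟨B, hB⟩ := bd _ hp.2.2
  -- the result itself
  obtain ⟨q, q1, q2, q3, q4, -⟩ := run_final hc hN (rho1 A B) rho1_anti rho1_mono rho1_inj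
    (fun _ => True) (fun _ _ _ _ _ _ _ _ _ _ _ _ _ _ _ => trivial)
    (sg_init hp hf hs hA hB) trivial
  have e : c = q := terminal_unique hp hr q1 ht q4.terminal
  subst e
  refine ⟨q2, q3, q4, ?_, ?_⟩
  · have L := std_lft k2
    obtain ⟨-, G', l1, l2⟩ := lift2 hp hr L
    have pf := L.perf hp.2.2
    obtain ⟨B', hB'⟩ := bd _ pf
    have hp' : PP γ (p.1, std N p.2) := by
      refine ⟨fun i j => ?_, hp.2.1, pf⟩
      rcases hp.1 i j with g | g
      · exact Or.inl g
      · exact Or.inr (L.zr i j g)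
    obtain ⟨r, r1, r2, r3, r4, -, r5⟩ := run_final (p := (p.1, std N p.2)) hc hN (rho2 A)
      rho2_anti rho2_mono rho2_inj
      (fun p' => Inj2 p'.2 ∧ Kn (wd N N p'.1) (wd N N p.1)) (inv2_step hc hN _)
      (sg_init hp' (fun i j g => (hf i j g).imp id L.ne.1)
        (fun i j k l hi hj g => hs i j k l hi hj (L.ne.2 g)) hA hB')
      ⟨std_inj hp.2.2 k2, Kn.refl _⟩
    have s : Sorted2 (c.1, G') := fun i j k l hi hj g => l1.zr _ _ (q4 i j k l hi hj g)
    have e : (c.1, G') = r := terminal_unique hp' l2 r1 s.terminal r4.terminal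
    rw [← e] at r5
    exact r5
  · have L := std_lft k1
    obtain ⟨-, G', l1, l2⟩ := lift1 hp hr L
    have pf := L.perf hp.2.1
    obtain ⟨A', hA'⟩ := bd _ pf
    have hp' : PP γ (std N p.1, p.2) := by
      refine ⟨fun i j => ?_, pf, hp.2.2⟩
      rcases hp.1 i j with g | g
      · exact Or.inl (L.zr i j g)
      · exact Or.inr g
    obtain ⟨r, r1, r2, r3, r4, -, r5⟩ := run_final (p := (std N p.1, p.2)) hc hN (rho1 A' B)
      rho1_anti rho1_mono rho1_inj
      (fun p' => Inj2 p'.1 ∧ Kn (wd N N p'.2) (wd N N p.2)) (inv1_step hc hN _)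
      (sg_init hp' (fun i j g => (hf i j g).imp L.ne.1 id)
        (fun i j k l hi hj g => L.zr _ _ (hs i j k l hi hj g)) hA' hB)
      ⟨std_inj hp.2.1 k1, Kn.refl _⟩
    have s : Sorted2 (G', c.2) := fun i j k l hi hj g => q4 i j k l hi hj (l1.ne.2 g)
    have e : (G', c.2) = r := terminal_unique hp' l2 r1 s.terminal r4.terminal
    rw [← e] at r5
    exact r5

end

theorem main_thm
    (mu la nu : ℕ → ℕ)
    (hmu : IsPartitionFun mu) (hla : IsPartitionFun la) (hnu : IsPartitionFun nu)
    (h1 : ∀ i, mu i ≤ la i) (h2 : ∀ i, la i ≤ nu i)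
    (S T : ℕ → ℕ → ℕ)
    (hS : IsSkewSSYT la mu S) (hT : IsSkewSSYT nu la T)
    (c : (ℕ → ℕ → ℕ) × (ℕ → ℕ → ℕ))
    (hreach : Relation.ReflTransGen (SwitchStep (SkewYCell nu mu)) (S, T) c)
    (hterm : ∀ q, ¬ SwitchStep (SkewYCell nu mu) c q) :
    ∃ kappa : ℕ → ℕ, IsPartitionFun kappa ∧
      (∀ i, mu i ≤ kappa i) ∧ (∀ i, kappa i ≤ nu i) ∧
      IsSkewSSYT kappa mu c.2 ∧ IsSkewSSYT nu kappa c.1 ∧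
      RectOf nu kappa c.1 = RectOf la mu S ∧
      RectOf kappa mu c.2 = RectOf nu la T := by
  classical
  have cell : ∀ i j, SkewYCell nu mu i j ↔ (mu i ≤ j ∧ j < nu i) := by
    intro i j; simp only [SkewYCell, YCell]; omega
  have sS : ∀ i j, S i j ≠ 0 ↔ (mu i ≤ j ∧ j < la i) := by
    intro i j; rw [hS.1]; simp only [SkewYCell, YCell]; omega
  have sT : ∀ i j, T i j ≠ 0 ↔ (la i ≤ j ∧ j < nu i) := by
    intro i j; rw [hT.1]; simp only [SkewYCell, YCell]; omega
  have pS := ssyt_perf hla.1 hS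
  have pT := ssyt_perf hnu.1 hT
  have hc : Cvx (SkewYCell nu mu) := by
    intro i j k l m n g1 g2 q1 q2 q3 q4
    rw [cell] at *
    have := anti_le hmu.1 q1
    have := anti_le hnu.1 q2
    omega
  have hN : ∀ i j, SkewYCell nu mu i j → i < len nu + nu 0 ∧ j < len nu + nu 0 := by
    intro i j g
    rw [cell] at g
    have := (len_spec hnu i).1 (by omega)
    have := anti_le hnu.1 (Nat.zero_le i)
    omega
  have hp : PP (SkewYCell nu mu) (S, T) := by
    refine ⟨fun i j => ?_, ⟨fun i j g => ?_, pS.2⟩, ⟨fun i j g => ?_, pT.2⟩⟩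
    · have := sS i j
      have := sT i j
      show S i j = 0 ∨ T i j = 0
      omega
    · have := (sS i j).1 g
      have := h2 i
      rw [cell]; omega
    · have := (sT i j).1 g
      have := h1 i
      rw [cell]; omega
  obtain ⟨cp, cf, cs, ck1, ck2⟩ := main_kn hc hN hp
    (fun i j g => by
      rw [cell] at g
      have := sS i j
      have := sT i j
      show S i j ≠ 0 ∨ T i j ≠ 0
      omega)
    (fun i j k l hi hj g => by
      have g1 := (sT i j).1 g
      have g2 := sS k l
      have := anti_le hla.1 hi
      show S k l = 0
      omega) hreach hterm
  have zz : ∀ i j, nu i ≤ j → c.1 i j = 0 ∧ c.2 i j = 0 := by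
    intro i j hj
    constructor
    · by_contra g
      have := (cell _ _).1 (cp.2.1.1 i j g)
      omega
    · by_contra g
      have := (cell _ _).1 (cp.2.2.1 i j g)
      omega
  have hex : ∀ i, ∃ j, mu i ≤ j ∧ c.2 i j = 0 := fun i =>
    ⟨nu i, (h1 i).trans (h2 i), (zz i _ le_rfl).2⟩
  obtain ⟨ka, hka⟩ : ∃ ka : ℕ → ℕ, ∀ i, (mu i ≤ ka i ∧ c.2 i (ka i) = 0) ∧
      ∀ j, j < ka i → mu i ≤ j → c.2 i j ≠ 0 := by
    refine ⟨fun i => Nat.find (hex i), fun i => ⟨Nat.find_spec (hex i), fun j hj hm h0 => ?_⟩⟩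
    exact Nat.find_min (hex i) hj ⟨hm, h0⟩
  have kle : ∀ i, ka i ≤ nu i := by
    intro i
    by_contra hlt
    exact (hka i).2 (nu i) (by omega) ((h1 i).trans (h2 i)) (zz i _ le_rfl).2
  have s2 : ∀ i j, c.2 i j ≠ 0 ↔ (mu i ≤ j ∧ j < ka i) := by
    intro i j
    constructor
    · intro g
      have g1 := (cell _ _).1 (cp.2.2.1 i j g)
      refine ⟨g1.1, ?_⟩
      by_contra hlt
      obtain ⟨⟨e1, e2⟩, -⟩ := hka i
      have g2 : c.1 i (ka i) ≠ 0 := by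
        have := cf i (ka i) ((cell _ _).2 (by omega))
        omega
      exact g (cs i (ka i) i j le_rfl (by omega) g2)
    · intro g
      exact (hka i).2 j g.2 g.1
  have s1 : ∀ i j, c.1 i j ≠ 0 ↔ (ka i ≤ j ∧ j < nu i) := by
    intro i j
    have e1 := s2 i j
    have e2 := cp.1 i j
    have e3 := (hka i).1.1
    constructor
    · intro g
      have g1 := (cell _ _).1 (cp.2.1.1 i j g)
      omega
    · intro g
      have := cf i j ((cell _ _).2 (by omega))
      omega
  have kp : IsPartitionFun ka := by
    refine ⟨fun i => ?_, ?_⟩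
    · by_contra hlt
      have e1 := hmu.1 i
      have e2 := hnu.1 i
      have e3 := (hka i).1.1
      have e4 := kle (i + 1)
      have g1 : c.1 i (ka i) ≠ 0 := (s1 _ _).2 (by omega)
      have g2 : c.2 (i + 1) (ka i) ≠ 0 := (s2 _ _).2 (by omega)
      exact g2 (cs _ _ _ _ (by omega) le_rfl g1)
    · obtain ⟨M, hM⟩ := hnu.2
      exact ⟨M, by have := kle M; omega⟩
  have t2 : IsSkewSSYT ka mu c.2 := perf_ssyt cp.2.2 (fun i j => by
    rw [s2]; simp only [SkewYCell, YCell]; omega)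
  have t1 : IsSkewSSYT nu ka c.1 := perf_ssyt cp.2.1 (fun i j => by
    rw [s1]; simp only [SkewYCell, YCell]; omega)
  have lenle : ∀ p : ℕ → ℕ, IsPartitionFun p → (∀ i, p i ≤ nu i) → len p ≤ len nu := by
    intro p hp hle
    by_contra hlt
    have a1 := (len_spec hp (len nu)).2 (by omega)
    have a2 := len_spec hnu (len nu)
    have := hle (len nu)
    omega
  have l1 := lenle la hla h2
  have l2 := lenle ka kp kle
  have z1 := h2 0
  have z2 := kle 0
  refine ⟨ka, kp, fun i => (hka i).1.1, kle, t2, t1, ?_, ?_⟩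
  · exact rect_eq hnu kp kle t1 hla hmu h1 hS (by omega) (by omega) (by omega) (by omega) ck1
  · exact rect_eq kp hmu (fun i => (hka i).1.1) t2 hnu hla h2 hT (by omega) (by omega) (by omega)
      (by omega) ck2

/-- Benkart–Sottile–Stroomer.  Let `S`, `T` be skew semistandard
Young tableaux with `T` extending `S` (`S` of shape `λ/μ`, `T` of shape `ν/λ`),
and let `^S T ∪ S_T` be the result of the tableau switching procedure applied to
`S ∪ T` (a terminal configuration `c = (S_T, ^S T)` reachable by switching steps).
Then: (1) `^S T` and `S_T` are skew semistandard Young tableaux and `S_T` extends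
`^S T`; (2) together they occupy the boxes of `ν/μ`; (3) `Rect(S_T) = Rect(S)`;
(4) `Rect(^S T) = Rect(T)`. -/
theorem switching_properties
    (mu la nu : ℕ → ℕ)
    (hmu : IsPartitionFun mu) (hla : IsPartitionFun la) (hnu : IsPartitionFun nu)
    (h1 : ∀ i, mu i ≤ la i) (h2 : ∀ i, la i ≤ nu i)
    (S T : ℕ → ℕ → ℕ)
    (hS : IsSkewSSYT la mu S) (hT : IsSkewSSYT nu la T)
    (c : (ℕ → ℕ → ℕ) × (ℕ → ℕ → ℕ))
    (hreach : Relation.ReflTransGen (SwitchStep (SkewYCell nu mu)) (S, T) c)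
    (hterm : ∀ q, ¬ SwitchStep (SkewYCell nu mu) c q) :
    ∃ kappa : ℕ → ℕ, IsPartitionFun kappa ∧
      (∀ i, mu i ≤ kappa i) ∧ (∀ i, kappa i ≤ nu i) ∧
      IsSkewSSYT kappa mu c.2 ∧ IsSkewSSYT nu kappa c.1 ∧
      RectOf nu kappa c.1 = RectOf la mu S ∧
      RectOf kappa mu c.2 = RectOf nu la T := by
  exact main_thm mu la nu hmu hla hnu h1 h2 S T hS hT c hreach hterm

end SLR
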